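/- arXiv:2401.12664 — 6 statements merged into one kernel-verified Lean document; each statement's English description precedes it below -/
import Mathlib

section
/- Assume that for each n the interpolation nodes obey the density function w, and that each external field φ_n is twice continuously differentiable on [-1,1] with φ_n''(x) ≥ M for all n and all x ∈ [-1,1], where M is a constant independent of n. Then there exists N > 0 such that for every n > N and every x ∈ [-1,1] that is not one of the nodes x_0^{(n)},...,x_n^{(n)}, the discrete potential satisfies U_n''(x) > 0; in particular U_n is strictly convex on each open interval between consecutive nodes. -/
open Filter Finset Set

noncomputable def discretePotential (X : ℕ → ℕ → ℝ) (φ : ℕ → ℝ → ℝ) (n : ℕ) (x : ℝ) : ℝ :=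
  (1 / (n + 1 : ℝ)) * ∑ i ∈ Finset.range (n + 1), Real.log (1 / |x - X n i|) + φ n x

noncomputable def continuousPotential (w : ℝ → ℝ) (φ : ℝ → ℝ) (x : ℝ) : ℝ :=
  (∫ t in (-1 : ℝ)..1, Real.log (1 / |x - t|) * w t) + φ x

noncomputable def baryWeight (X : ℕ → ℕ → ℝ) (φ : ℕ → ℝ → ℝ) (n i : ℕ) : ℝ :=
  Real.exp ((n + 1 : ℝ) * φ n (X n i)) / ∏ k ∈ (Finset.range (n + 1)).erase i, |X n i - X n k|

noncomputable def lagrangeBasis (X : ℕ → ℕ → ℝ) (φ : ℕ → ℝ → ℝ) (n k : ℕ) (x : ℝ) : ℝ :=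
  ((∏ i ∈ (Finset.range (n + 1)).erase k, (x - X n i)) /
      (∏ i ∈ (Finset.range (n + 1)).erase k, (X n k - X n i))) *
    Real.exp ((n + 1 : ℝ) * (φ n (X n k) - φ n x))

noncomputable def lebesgueFun (X : ℕ → ℕ → ℝ) (φ : ℕ → ℝ → ℝ) (n : ℕ) (x : ℝ) : ℝ :=
  ∑ k ∈ Finset.range (n + 1), |lagrangeBasis X φ n k x|

def ObeysDensity (X : ℕ → ℕ → ℝ) (w : ℝ → ℝ) : Prop :=
  ∀ a b : ℝ, -1 ≤ a → a ≤ b → b ≤ 1 →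
    Filter.Tendsto
      (fun n : ℕ =>
        (((Finset.range (n + 1)).filter fun i => a ≤ X n i ∧ X n i ≤ b).card : ℝ) / (n + 1))
      Filter.atTop (nhds (∫ t in a..b, w t))

lemma exists_subinterval_mem (K : ℕ) (hK : 0 < K) (x : ℝ) (hx : x ∈ Set.Icc (-1 : ℝ) 1) :
    ∃ k < K, -1 + k * (2 / K : ℝ) ≤ x ∧ x ≤ -1 + (k + 1) * (2 / K : ℝ) := by
  have hK' : (0 : ℝ) < K := by exact_mod_cast hK
  have hh : (0 : ℝ) < 2 / K := by positivity
  have hKh : (K : ℝ) * (2 / K) = 2 := by field_simp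
  rcases hx.2.lt_or_eq with h | rfl
  · have h0 : 0 ≤ (x + 1) / (2 / K : ℝ) := div_nonneg (by linarith [hx.1]) hh.le
    refine ⟨⌊(x + 1) / (2 / K : ℝ)⌋₊, ?_, ?_, ?_⟩
    · rw [Nat.floor_lt h0, div_lt_iff₀ hh]
      linarith
    · have := (le_div_iff₀ hh).1 (Nat.floor_le h0)
      linarith
    · have := (div_lt_iff₀ hh).1 (Nat.lt_floor_add_one ((x + 1) / (2 / K : ℝ)))
      linarith
  · refine ⟨K - 1, by omega, ?_, ?_⟩ <;> rw [Nat.cast_pred hK] <;> linarith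

/-- Mass of a short interval containing `x` bounds the averaged inverse square distance to `x`. -/
lemma le_mean_inv_sq_sub (u : ℕ → ℝ) (n : ℕ) (a b x q : ℝ) (hab : a < b) (hax : a ≤ x)
    (hxb : x ≤ b) (hx : ∀ i, i ≤ n → x ≠ u i)
    (hq : q ≤ (((Finset.range (n + 1)).filter fun i => a ≤ u i ∧ u i ≤ b).card : ℝ) / (n + 1)) :
    q / (b - a) ^ 2 ≤ (1 / (n + 1 : ℝ)) * ∑ i ∈ Finset.range (n + 1), 1 / (x - u i) ^ 2 := by
  have hd : 0 < b - a := sub_pos.2 hab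
  have hn : (0 : ℝ) < n + 1 := by positivity
  have key : (((Finset.range (n + 1)).filter fun i => a ≤ u i ∧ u i ≤ b).card : ℝ) *
      (1 / (b - a) ^ 2) ≤ ∑ i ∈ Finset.range (n + 1), 1 / (x - u i) ^ 2 := by
    rw [← nsmul_eq_mul]
    refine le_trans (Finset.card_nsmul_le_sum _ (fun i => 1 / (x - u i) ^ 2) _ ?_)
      (Finset.sum_le_sum_of_subset_of_nonneg (Finset.filter_subset _ _)
        fun i _ _ => by positivity)
    intro i hi
    obtain ⟨hi, h1, h2⟩ := Finset.mem_filter.1 hi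
    have hne : x - u i ≠ 0 := sub_ne_zero.2 (hx i (by have := Finset.mem_range.1 hi; omega))
    refine one_div_le_one_div_of_le (by positivity) ?_
    rw [sq_le_sq, abs_of_pos hd, abs_le]
    constructor <;> linarith
  calc q / (b - a) ^ 2
      ≤ (((Finset.range (n + 1)).filter fun i => a ≤ u i ∧ u i ≤ b).card : ℝ) / (n + 1) /
          (b - a) ^ 2 := by gcongr
    _ = (1 / (n + 1 : ℝ)) * ((((Finset.range (n + 1)).filter
          fun i => a ≤ u i ∧ u i ≤ b).card : ℝ) * (1 / (b - a) ^ 2)) := by ring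
    _ ≤ _ := by gcongr

/-- For nodes obeying a positive density, the second derivative of the logarithmic part of the
discrete potential is eventually larger than any given constant. -/
lemma eventually_lt_mean_inv_sq_sub (X : ℕ → ℕ → ℝ) (w : ℝ → ℝ)
    (hw_cont : ContinuousOn w (Set.Icc (-1 : ℝ) 1))
    (hw_pos : ∀ t ∈ Set.Icc (-1 : ℝ) 1, 0 < w t) (hobeys : ObeysDensity X w) (C : ℝ) :
    ∀ᶠ n : ℕ in Filter.atTop, ∀ x ∈ Set.Icc (-1 : ℝ) 1, (∀ i, i ≤ n → x ≠ X n i) →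
      C < (1 / (n + 1 : ℝ)) * ∑ i ∈ Finset.range (n + 1), 1 / (x - X n i) ^ 2 := by
  obtain ⟨t₀, ht₀, hmin⟩ := isCompact_Icc.exists_isMinOn
    (Set.nonempty_Icc.2 (by norm_num : (-1 : ℝ) ≤ 1)) hw_cont
  have hm : 0 < w t₀ := hw_pos t₀ ht₀
  set m := w t₀
  obtain ⟨K, hKC⟩ := exists_nat_gt (max 0 (4 * C / m))
  have hK' : (0 : ℝ) < K := (le_max_left _ _).trans_lt hKC
  have hK : 0 < K := by exact_mod_cast hK'
  have hC : 4 * C < K * m := (div_lt_iff₀ hm).1 ((le_max_right _ _).trans_lt hKC)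
  set h : ℝ := 2 / K with hh_def
  have hh : 0 < h := by positivity
  have hKh : (K : ℝ) * h = 2 := by rw [hh_def]; field_simp
  have hev : ∀ᶠ n : ℕ in Filter.atTop, ∀ k ∈ Finset.range K,
      m * h / 2 ≤ (((Finset.range (n + 1)).filter fun i =>
        -1 + k * h ≤ X n i ∧ X n i ≤ -1 + (k + 1) * h).card : ℝ) / (n + 1) := by
    rw [Filter.eventually_all_finset]
    intro k hk
    have hkK : (k : ℝ) + 1 ≤ K := by exact_mod_cast Finset.mem_range.1 hk
    have ha : -1 ≤ -1 + k * h := by have : 0 ≤ k * h := by positivity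
                                    linarith
    have hab : -1 + k * h ≤ -1 + (k + 1) * h := by linarith
    have hb : -1 + (k + 1) * h ≤ 1 := by
      have : ((k : ℝ) + 1) * h ≤ K * h := by gcongr
      linarith
    have hsub : Set.Icc (-1 + k * h) (-1 + (k + 1) * h) ⊆ Set.Icc (-1 : ℝ) 1 :=
      Set.Icc_subset_Icc ha hb
    have hint : m * h ≤ ∫ t in (-1 + k * h)..(-1 + (k + 1) * h), w t := by
      have hmono := intervalIntegral.integral_mono_on hab
        (intervalIntegrable_const (c := m) (μ := MeasureTheory.volume))
        ((hw_cont.mono hsub).intervalIntegrable_of_Icc hab)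
        fun t ht => hmin (hsub ht)
      rw [intervalIntegral.integral_const, smul_eq_mul] at hmono
      linarith
    refine ((hobeys _ _ ha hab hb).eventually (lt_mem_nhds ?_)).mono fun n hn => le_of_lt hn
    have : 0 < m * h := by positivity
    linarith
  filter_upwards [hev] with n hn x hx hne
  obtain ⟨k, hk, h1, h2⟩ := exists_subinterval_mem K hK x hx
  have hle := le_mean_inv_sq_sub (X n) n _ _ x _ (by linarith) h1 h2 hne
    (hn k (Finset.mem_range.2 hk))
  refine lt_of_lt_of_le ?_ hle
  have : m * h / 2 / (-1 + (k + 1) * h - (-1 + k * h)) ^ 2 = K * m / 4 := by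
    have hd : -1 + (k + 1) * h - (-1 + k * h) = h := by ring
    rw [hd, hh_def]
    field_simp
    norm_num
  rw [this]
  linarith

lemma hasDerivAt_discretePotential (X : ℕ → ℕ → ℝ) (φ : ℕ → ℝ → ℝ) (n : ℕ) (x d : ℝ)
    (hφ : HasDerivAt (φ n) d x) (hx : ∀ i, i ≤ n → x ≠ X n i) :
    HasDerivAt (discretePotential X φ n)
      ((1 / (n + 1 : ℝ)) * ∑ i ∈ Finset.range (n + 1), -(x - X n i)⁻¹ + d) x := by
  refine HasDerivAt.add (HasDerivAt.const_mul _ (HasDerivAt.fun_sum fun i hi => ?_)) hφ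
  have hne : x - X n i ≠ 0 := sub_ne_zero.2 (hx i (by have := Finset.mem_range.1 hi; omega))
  simpa [Real.log_inv] using (((hasDerivAt_id x).sub_const (X n i)).log hne).fun_neg

lemma hasDerivAt_mean_neg_inv_sub (u : ℕ → ℝ) (g : ℝ → ℝ) (n : ℕ) (x d : ℝ)
    (hg : HasDerivAt g d x) (hx : ∀ i, i ≤ n → x ≠ u i) :
    HasDerivAt (fun y => (1 / (n + 1 : ℝ)) * ∑ i ∈ Finset.range (n + 1), -(y - u i)⁻¹ + g y)
      ((1 / (n + 1 : ℝ)) * ∑ i ∈ Finset.range (n + 1), 1 / (x - u i) ^ 2 + d) x := by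
  refine HasDerivAt.add (HasDerivAt.const_mul _ (HasDerivAt.fun_sum fun i hi => ?_)) hg
  have hne : x - u i ≠ 0 := sub_ne_zero.2 (hx i (by have := Finset.mem_range.1 hi; omega))
  have := (((hasDerivAt_id x).sub_const (u i)).fun_inv hne).fun_neg
  simpa [neg_div] using this

theorem stmt_0 (X : ℕ → ℕ → ℝ) (w : ℝ → ℝ) (φ φ' φ'' : ℕ → ℝ → ℝ) (M : ℝ)
    (hXorder : ∀ n, 1 ≤ n → ∀ i j : ℕ, i < j → j ≤ n → X n i < X n j)
    (hXmem : ∀ n, 1 ≤ n → ∀ i, i ≤ n → X n i ∈ Set.Icc (-1 : ℝ) 1)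
    (hw_cont : ContinuousOn w (Set.Icc (-1 : ℝ) 1))
    (hw_pos : ∀ t ∈ Set.Icc (-1 : ℝ) 1, 0 < w t)
    (hw_int : (∫ t in (-1 : ℝ)..1, w t) = 1)
    (hobeys : ObeysDensity X w)
    (hφd1 : ∀ n, ∀ x ∈ Set.Icc (-1 : ℝ) 1, HasDerivAt (φ n) (φ' n x) x)
    (hφd2 : ∀ n, ∀ x ∈ Set.Icc (-1 : ℝ) 1, HasDerivAt (φ' n) (φ'' n x) x)
    (hφ''cont : ∀ n, ContinuousOn (φ'' n) (Set.Icc (-1 : ℝ) 1))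
    (hM : ∀ n, ∀ x ∈ Set.Icc (-1 : ℝ) 1, M ≤ φ'' n x)
    :
    ∃ N : ℕ, 0 < N ∧ ∀ n : ℕ, N < n →
      (∀ x ∈ Set.Icc (-1 : ℝ) 1, (∀ i, i ≤ n → x ≠ X n i) →
        0 < (1 / (n + 1 : ℝ)) * ∑ i ∈ Finset.range (n + 1), 1 / (x - X n i) ^ 2 + φ'' n x) ∧
      (∀ i, 1 ≤ i → i ≤ n →
        StrictConvexOn ℝ (Set.Ioo (X n (i - 1)) (X n i)) (discretePotential X φ n)) := by
  obtain ⟨N, hN⟩ := Filter.eventually_atTop.1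
    (eventually_lt_mean_inv_sq_sub X w hw_cont hw_pos hobeys (-M))
  refine ⟨N + 1, N.succ_pos, fun n hn => ?_⟩
  have hpos : ∀ x ∈ Set.Icc (-1 : ℝ) 1, (∀ i, i ≤ n → x ≠ X n i) →
      0 < (1 / (n + 1 : ℝ)) * ∑ i ∈ Finset.range (n + 1), 1 / (x - X n i) ^ 2 + φ'' n x := by
    intro x hx hne
    linarith [hN n (by omega) x hx hne, hM n x hx]
  refine ⟨hpos, fun i hi hin => ?_⟩
  have hn1 : 1 ≤ n := by omega
  have hmono : ∀ j k : ℕ, j ≤ k → k ≤ n → X n j ≤ X n k := by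
    intro j k hjk hk
    rcases hjk.lt_or_eq with h | rfl
    · exact (hXorder n hn1 j k h hk).le
    · exact le_rfl
  have hmem : ∀ x ∈ Set.Ioo (X n (i - 1)) (X n i), x ∈ Set.Icc (-1 : ℝ) 1 := fun x hx =>
    ⟨(hXmem n hn1 (i - 1) (by omega)).1.trans hx.1.le, hx.2.le.trans (hXmem n hn1 i hin).2⟩
  have hne : ∀ x ∈ Set.Ioo (X n (i - 1)) (X n i), ∀ j, j ≤ n → x ≠ X n j := by
    intro x hx j hj
    rcases Nat.lt_or_ge j i with h | h
    · exact ((hmono j (i - 1) (by omega) (by omega)).trans_lt hx.1).ne'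
    · exact (hx.2.trans_le (hmono i j h hj)).ne
  have hderiv : ∀ x ∈ Set.Ioo (X n (i - 1)) (X n i), HasDerivAt (discretePotential X φ n)
      ((1 / (n + 1 : ℝ)) * ∑ j ∈ Finset.range (n + 1), -(x - X n j)⁻¹ + φ' n x) x :=
    fun x hx => hasDerivAt_discretePotential X φ n x _ (hφd1 n x (hmem x hx)) (hne x hx)
  refine strictConvexOn_of_deriv2_pos' (convex_Ioo _ _)
    (fun x hx => (hderiv x hx).continuousAt.continuousWithinAt) fun x hx => ?_
  have heq : deriv (discretePotential X φ n) =ᶠ[nhds x] fun y =>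
      (1 / (n + 1 : ℝ)) * ∑ j ∈ Finset.range (n + 1), -(y - X n j)⁻¹ + φ' n y := by
    filter_upwards [isOpen_Ioo.mem_nhds hx] with y hy using (hderiv y hy).deriv
  have hderiv2 := (hasDerivAt_mean_neg_inv_sub (X n) (φ' n) n x _ (hφd2 n x (hmem x hx))
    (hne x hx)).congr_of_eventuallyEq heq
  rw [Function.iterate_succ, Function.iterate_one, Function.comp_apply, hderiv2.deriv]
  exact hpos x (hmem x hx) (hne x hx)
end

section
/- Assume the nodes satisfy a_1 n^{-b_1} ≤ x_i^{(n)} - x_{i-1}^{(n)} ≤ a_2 n^{-b_2} for all i and n (with a_1, a_2 > 0), each φ_n is differentiable, and |φ_n'(x)| < M_2 · log n for all x ∈ (-1 + a_1 n^{-b_1-1}, 1 - a_1 n^{-b_1-1}). Then for all sufficiently large n and every i ∈ {1,...,n}, the derivative of the discrete potential satisfies U_n'(x_{i-1}^{(n)} + a_1 n^{-b_1-1}) < 0. -/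
open Filter Finset Set

theorem mul_le_sub_of_forall_le_sub {x : ℕ → ℝ} {n : ℕ} {g : ℝ}
    (h : ∀ i, 1 ≤ i → i ≤ n → g ≤ x i - x (i - 1)) (p k : ℕ) (hk : p + k ≤ n) :
    k * g ≤ x (p + k) - x p := by
  induction k with
  | zero => simp
  | succ k ih =>
    have h₁ := ih (by omega)
    have h₂ := h (p + (k + 1)) (by omega) hk
    rw [show p + (k + 1) - 1 = p + k by omega] at h₂
    push_cast
    linarith

theorem sum_one_div_add_one_le_one_add_log (m : ℕ) :
    ∑ k ∈ Finset.range m, 1 / ((k : ℝ) + 1) ≤ 1 + Real.log m := by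
  have h := harmonic_le_one_add_log m
  simpa [harmonic] using h

/-- Just to the right of the node `x p`, the contribution of that node dominates the sum of
`1 / (y - x j)`, up to a logarithmic correction from the nodes further right. -/
theorem le_sum_one_div_sub {x : ℕ → ℝ} {n p : ℕ} {δ : ℝ} (hδ : 0 < δ) (hn : 2 ≤ n) (hp : p < n)
    (h : ∀ i, 1 ≤ i → i ≤ n → n * δ ≤ x i - x (i - 1)) :
    1 / δ * (1 - 2 * (1 + Real.log n) / n) ≤
      ∑ j ∈ Finset.range (n + 1), 1 / (x p + δ - x j) := by
  have hn' : (2 : ℝ) ≤ n := by exact_mod_cast hn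
  obtain ⟨m, rfl⟩ : ∃ m, n = p + m := ⟨n - p, by omega⟩
  set N : ℝ := ((p + m : ℕ) : ℝ) with hN
  have hleft : 1 / δ ≤ ∑ j ∈ Finset.range (p + 1), 1 / (x p + δ - x j) := by
    have h₁ := Finset.single_le_sum (f := fun j => 1 / (x p + δ - x j))
      (s := Finset.range (p + 1)) (fun j hj => ?_) (Finset.self_mem_range_succ p)
    · simpa using h₁
    · have hj' : j ≤ p := by simpa [Nat.lt_succ_iff] using hj
      have h₂ := mul_le_sub_of_forall_le_sub h j (p - j) (by omega)
      rw [Nat.add_sub_cancel' hj'] at h₂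
      have h₃ : 0 ≤ ((p - j : ℕ) : ℝ) * (N * δ) := by positivity
      exact one_div_nonneg.2 (by linarith)
  have hright : -(2 / (N * δ) * (1 + Real.log N)) ≤
      ∑ k ∈ Finset.range m, 1 / (x p + δ - x (p + 1 + k)) := by
    have h₁ : ∀ k ∈ Finset.range m,
        -(2 / (N * δ)) * (1 / ((k : ℝ) + 1)) ≤ 1 / (x p + δ - x (p + 1 + k)) := by
      intro k hk
      have hk' := Finset.mem_range.1 hk
      have h₂ := mul_le_sub_of_forall_le_sub h p (k + 1) (by omega)
      rw [show p + (k + 1) = p + 1 + k by omega] at h₂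
      push_cast at h₂
      have h₃ : 0 ≤ (k : ℝ) * (N * δ) := by positivity
      have h₄ : 2 * δ ≤ N * δ := by gcongr
      have h₅ : ((k : ℝ) + 1) * (N * δ) / 2 ≤ x (p + 1 + k) - x p - δ := by
        nlinarith only [h₂, h₃, h₄]
      have h₆ : 1 / (x (p + 1 + k) - x p - δ) ≤ 1 / (((k : ℝ) + 1) * (N * δ) / 2) :=
        one_div_le_one_div_of_le (by positivity) h₅
      have h₇ : 1 / (((k : ℝ) + 1) * (N * δ) / 2) = 2 / (N * δ) * (1 / ((k : ℝ) + 1)) := by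
        field_simp
      have h₈ : 1 / (x p + δ - x (p + 1 + k)) = -(1 / (x (p + 1 + k) - x p - δ)) := by
        rw [← one_div_neg_eq_neg_one_div]
        congr 1
        ring
      linarith
    have h₂ := Finset.sum_le_sum h₁
    rw [← Finset.mul_sum] at h₂
    refine le_trans ?_ h₂
    rw [neg_mul, neg_le_neg_iff]
    have hm : Real.log m ≤ Real.log N :=
      Real.log_le_log (by exact_mod_cast (by omega : 0 < m)) (by rw [hN]; push_cast; simp)
    have h₃ := sum_one_div_add_one_le_one_add_log m
    gcongr
    linarith
  rw [show p + m + 1 = p + 1 + m by omega, Finset.sum_range_add]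
  have h₁ : 1 / δ * (1 - 2 * (1 + Real.log N) / N) =
      1 / δ - 2 / (N * δ) * (1 + Real.log N) := by
    field_simp
  linarith

/-- A bound for the derivative on an open interval extends to its left endpoint. -/
theorem deriv_le_of_forall_Ioo_le {f f' : ℝ → ℝ} {a b C : ℝ} (hab : a < b)
    (hf : ∀ x ∈ Set.Ico a b, HasDerivAt f (f' x) x) (hC : ∀ x ∈ Set.Ioo a b, f' x ≤ C) :
    f' a ≤ C := by
  have hlim := (hf a ⟨le_rfl, hab⟩).tendsto_slope.mono_left
    (nhdsWithin_mono a (fun x (hx : x ∈ Set.Ioi a) => ne_of_gt hx))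
  refine le_of_tendsto hlim ?_
  filter_upwards [Ioo_mem_nhdsGT hab] with y hy
  obtain ⟨c, hc, hcy⟩ := exists_hasDerivAt_eq_slope f f' hy.1
    (fun x hx => (hf x ⟨hx.1, hx.2.trans_lt hy.2⟩).continuousAt.continuousWithinAt)
    (fun x hx => hf x ⟨hx.1.le, hx.2.trans hy.2⟩)
  rw [slope_def_field, ← hcy]
  exact hC c ⟨hc.1, hc.2.trans hy.2⟩

theorem eventually_mul_log_lt_self (C : ℝ) :
    ∀ᶠ n : ℕ in atTop, C * (1 + Real.log n) < n := by
  have h : (fun x : ℝ => C * (1 + Real.log x)) =o[atTop] (fun x : ℝ => x) :=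
    ((Asymptotics.isLittleO_const_id_atTop 1).add Real.isLittleO_log_id_atTop).const_mul_left C
  have h₁ := (h.bound (show (0 : ℝ) < 1 / 2 by norm_num)).and (eventually_gt_atTop 0)
  filter_upwards [tendsto_natCast_atTop_atTop.eventually h₁] with n hn
  obtain ⟨hn, hpos⟩ := hn
  rw [Real.norm_eq_abs, Real.norm_eq_abs, abs_of_pos hpos] at hn
  linarith [le_abs_self (C * (1 + Real.log n))]

theorem stmt_4 (X : ℕ → ℕ → ℝ) (φ φ' : ℕ → ℝ → ℝ) (M₂ a₁ a₂ b₁ b₂ : ℝ)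
    (ha₁ : 0 < a₁) (ha₂ : 0 < a₂)
    (hXorder : ∀ n, 1 ≤ n → ∀ i j : ℕ, i < j → j ≤ n → X n i < X n j)
    (hXmem : ∀ n, 1 ≤ n → ∀ i, i ≤ n → X n i ∈ Set.Icc (-1 : ℝ) 1)
    (hgap : ∀ n : ℕ, 1 ≤ n → ∀ i, 1 ≤ i → i ≤ n →
      a₁ * (n : ℝ) ^ (-b₁) ≤ X n i - X n (i - 1) ∧ X n i - X n (i - 1) ≤ a₂ * (n : ℝ) ^ (-b₂))
    (hφd : ∀ n, ∀ x ∈ Set.Icc (-1 : ℝ) 1, HasDerivAt (φ n) (φ' n x) x)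
    (hφ'bd : ∀ n : ℕ, 1 ≤ n →
      ∀ x ∈ Set.Ioo (-1 + a₁ * (n : ℝ) ^ (-b₁ - 1)) (1 - a₁ * (n : ℝ) ^ (-b₁ - 1)),
        |φ' n x| < M₂ * Real.log n) :
    ∃ N : ℕ, ∀ n : ℕ, N ≤ n → ∀ i, 1 ≤ i → i ≤ n →
      -(1 / (n + 1 : ℝ)) * (∑ j ∈ Finset.range (n + 1),
        1 / (X n (i - 1) + a₁ * (n : ℝ) ^ (-b₁ - 1) - X n j)) +
        φ' n (X n (i - 1) + a₁ * (n : ℝ) ^ (-b₁ - 1)) < 0 := by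
  obtain ⟨N, hN⟩ := eventually_atTop.1
    ((eventually_mul_log_lt_self 4).and (eventually_mul_log_lt_self (8 * |M₂|)))
  refine ⟨max N 3, fun n hn i hi hin => ?_⟩
  obtain ⟨h₁, h₂⟩ := hN n (le_of_max_le_left hn)
  have hn3 : 3 ≤ n := le_of_max_le_right hn
  have hn3' : (3 : ℝ) ≤ n := by exact_mod_cast hn3
  have hn0 : (0 : ℝ) < n := by linarith
  have hφb := hφ'bd n (by omega)
  set δ : ℝ := a₁ * (n : ℝ) ^ (-b₁ - 1) with hδ_def
  have hδ : 0 < δ := by positivity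
  have hnδ : a₁ * (n : ℝ) ^ (-b₁) = n * δ := by
    rw [hδ_def, Real.rpow_sub_one hn0.ne']
    field_simp
  have hg : ∀ j, 1 ≤ j → j ≤ n → n * δ ≤ X n j - X n (j - 1) := fun j hj hjn =>
    hnδ ▸ (hgap n (by omega) j hj hjn).1
  have htotal : n * (n * δ) ≤ 2 := by
    have h := mul_le_sub_of_forall_le_sub hg 0 n (by omega)
    rw [zero_add] at h
    linarith [(hXmem n (by omega) n le_rfl).2, (hXmem n (by omega) 0 (by omega)).1]
  have hsum := le_sum_one_div_sub hδ (by omega) (show i - 1 < n by omega) hg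
  have hlb : (n : ℝ) * n / 4 ≤
      ∑ j ∈ Finset.range (n + 1), 1 / (X n (i - 1) + δ - X n j) := by
    refine le_trans ?_ hsum
    have h₃ : 2 * (1 + Real.log n) / n ≤ 1 / 2 := by
      rw [div_le_iff₀ hn0]
      linarith
    have h₄ : (n : ℝ) * n / 2 ≤ 1 / δ := by
      rw [le_div_iff₀ hδ]
      linarith
    calc (n : ℝ) * n / 4 = (n * n / 2) * (1 / 2) := by ring
      _ ≤ 1 / δ * (1 - 2 * (1 + Real.log n) / n) := by
        gcongr
        linarith
  have hxl : -1 ≤ X n (i - 1) := (hXmem n (by omega) (i - 1) (by omega)).1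
  have hxr : X n (i - 1) + δ < 1 - δ := by
    have h₃ := hg i hi hin
    have h₄ := (hXmem n (by omega) i hin).2
    have h₅ : 3 * δ ≤ n * δ := by gcongr
    linarith
  have hder : φ' n (X n (i - 1) + δ) ≤ M₂ * Real.log n := by
    refine deriv_le_of_forall_Ioo_le hxr (fun x hx => hφd n x ⟨?_, ?_⟩)
      (fun x hx => (le_abs_self _).trans (hφb x ⟨?_, hx.2⟩).le)
    · linarith [hx.1]
    · linarith [hx.2]
    · linarith [hx.1]
  have hlog : M₂ * Real.log n ≤ |M₂| * (1 + Real.log n) := by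
    have h₃ : 0 ≤ Real.log n := Real.log_nonneg (by linarith)
    have h₄ := mul_le_mul_of_nonneg_right (le_abs_self M₂) h₃
    linarith [abs_nonneg M₂]
  have hmain : (n : ℝ) / 8 ≤ 1 / (n + 1 : ℝ) *
      ∑ j ∈ Finset.range (n + 1), 1 / (X n (i - 1) + δ - X n j) := by
    rw [one_div_mul_eq_div, le_div_iff₀ (by positivity)]
    nlinarith
  rw [neg_mul]
  linarith
end

section
/- Assume the nodes satisfy a_1 n^{-b_1} ≤ x_i^{(n)} - x_{i-1}^{(n)} ≤ a_2 n^{-b_2} for all i and n (with a_1, a_2 > 0), each φ_n is differentiable, and |φ_n'(x)| < M_2 · log n for all x ∈ (-1 + a_1 n^{-b_1-1}, 1 - a_1 n^{-b_1-1}). Then for all sufficiently large n and every i ∈ {1,...,n}, the derivative of the discrete potential satisfies U_n'(x_i^{(n)} - a_1 n^{-b_1-1}) > 0. -/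
open Filter Finset Set

lemma mul_le_sub_of_forall_step_le {x : ℕ → ℝ} {n : ℕ} {d : ℝ}
    (h : ∀ i, 1 ≤ i → i ≤ n → d ≤ x i - x (i - 1)) {i j : ℕ} (hji : j ≤ i) (hin : i ≤ n) :
    ((i : ℝ) - j) * d ≤ x i - x j := by
  induction i, hji using Nat.le_induction with
  | base => simp
  | succ k _ ih =>
    have h₁ := ih (by omega)
    have h₂ := h (k + 1) (by omega) hin
    rw [Nat.add_sub_cancel] at h₂
    push_cast
    linarith

lemma sum_range_inv_sub_le_one_add_log {i n : ℕ} (hin : i ≤ n) :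
    ∑ j ∈ Finset.range i, ((i : ℝ) - j)⁻¹ ≤ 1 + Real.log n := by
  calc ∑ j ∈ Finset.range i, ((i : ℝ) - j)⁻¹
      = ∑ j ∈ Finset.range i, ((j : ℝ) + 1)⁻¹ := by
        rw [← Finset.sum_range_reflect]
        refine Finset.sum_congr rfl fun j hj => ?_
        have hj' : 1 + j ≤ i := by rw [Finset.mem_range] at hj; omega
        rw [Nat.sub_sub, Nat.cast_sub hj']
        push_cast
        ring
    _ ≤ ∑ j ∈ Finset.range n, ((j : ℝ) + 1)⁻¹ :=
        Finset.sum_le_sum_of_subset_of_nonneg (Finset.range_mono hin)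
          fun j _ _ => by positivity
    _ = (harmonic n : ℝ) := by simp [harmonic]
    _ ≤ 1 + Real.log n := harmonic_le_one_add_log n

/-- By Darboux's theorem, a strict lower bound for a derivative on an open interval persists, in
weak form, at the right endpoint. -/
lemma le_deriv_right_endpoint {f f' : ℝ → ℝ} {a b c : ℝ} (hab : a < b)
    (hf : ∀ x ∈ Set.Ioc a b, HasDerivAt f (f' x) x) (hc : ∀ x ∈ Set.Ioo a b, c < f' x) :
    c ≤ f' b := by
  by_contra! hb
  obtain ⟨y, hay, hyb⟩ := exists_between hab
  obtain ⟨z, hz, hzc⟩ := exists_hasDerivWithinAt_eq_of_lt_of_gt hyb.le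
    (fun x hx => (hf x ⟨hay.trans_le hx.1, hx.2⟩).hasDerivWithinAt) (hc y ⟨hay, hyb⟩) hb
  exact (hc z ⟨hay.trans hz.1, hz.2⟩).ne' hzc

lemma sum_one_div_shifted_node_le {x : ℕ → ℝ} {n i : ℕ} {d : ℝ} (hd : 0 < d) (hn : 2 ≤ n)
    (h : ∀ i, 1 ≤ i → i ≤ n → d ≤ x i - x (i - 1)) (hin : i ≤ n) :
    ∑ j ∈ Finset.range (n + 1), 1 / (x i - d / n - x j) ≤
      (2 * (1 + Real.log n) - n) / d := by
  have hn' : (2 : ℝ) ≤ n := by exact_mod_cast hn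
  have hdn : 0 < d / n := by positivity
  have hdn2 : d / n ≤ d / 2 := by gcongr
  have hright : ∑ j ∈ Finset.Ico (i + 1) (n + 1), 1 / (x i - d / n - x j) ≤ 0 := by
    refine Finset.sum_nonpos fun j hj => ?_
    rw [Finset.mem_Ico] at hj
    have hij := mul_le_sub_of_forall_step_le h (i := j) (j := i) (by omega) (by omega)
    have hcast : (i : ℝ) ≤ j := by exact_mod_cast (by omega : i ≤ j)
    have := mul_nonneg (sub_nonneg.2 hcast) hd.le
    exact one_div_nonpos.2 (by linarith)
  have hleft : ∑ j ∈ Finset.range i, 1 / (x i - d / n - x j) ≤ 2 * (1 + Real.log n) / d := by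
    calc ∑ j ∈ Finset.range i, 1 / (x i - d / n - x j)
        ≤ ∑ j ∈ Finset.range i, 2 / d * ((i : ℝ) - j)⁻¹ := by
          refine Finset.sum_le_sum fun j hj => ?_
          rw [Finset.mem_range] at hj
          have hij := mul_le_sub_of_forall_step_le h hj.le hin
          have hcast : (1 : ℝ) ≤ i - j := by
            have : (j : ℝ) + 1 ≤ i := by exact_mod_cast hj
            linarith
          rw [← div_eq_mul_inv, div_div, div_le_div_iff₀ (by nlinarith) (by positivity)]
          nlinarith
      _ = 2 / d * ∑ j ∈ Finset.range i, ((i : ℝ) - j)⁻¹ := by rw [Finset.mul_sum]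
      _ ≤ 2 / d * (1 + Real.log n) := by
          gcongr
          exact sum_range_inv_sub_le_one_add_log hin
      _ = 2 * (1 + Real.log n) / d := by ring
  have hmid : 1 / (x i - d / n - x i) = -(n / d) := by
    rw [sub_sub_cancel_left, one_div, inv_neg, inv_div]
  rw [← Finset.sum_range_add_sum_Ico _ (by omega : i + 1 ≤ n + 1), Finset.sum_range_succ, hmid,
    sub_div]
  linarith

lemma eventually_add_one_mul_mul_log_lt (M : ℝ) :
    ∀ᶠ n : ℕ in Filter.atTop,
      0 ≤ (n : ℝ) - 2 * (1 + Real.log n) ∧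
      (n + 1 : ℝ) * (M * Real.log n) < n / 2 * (n - 2 * (1 + Real.log n)) := by
  have hc : 0 < 1 / (8 * (|M| + 1)) := by positivity
  have hlog := (Real.isLittleO_log_id_atTop.comp_tendsto
    (tendsto_natCast_atTop_atTop (R := ℝ))).bound hc
  filter_upwards [hlog, Filter.eventually_ge_atTop 16] with n hn hn16
  have hn' : (16 : ℝ) ≤ n := by exact_mod_cast hn16
  have hpos : 0 ≤ Real.log n := Real.log_nonneg (by linarith)
  simp only [Function.comp_apply, id, Real.norm_eq_abs, abs_of_nonneg hpos, Nat.abs_cast] at hn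
  have hM : 8 * ((|M| + 1) * Real.log n) ≤ n := by
    rw [one_div, inv_mul_eq_div, le_div_iff₀ (by positivity)] at hn
    linarith
  have hMl : M * Real.log n ≤ |M| * Real.log n := by gcongr; exact le_abs_self M
  have hMl0 : 0 ≤ |M| * Real.log n := by positivity
  have h₁ : 8 * Real.log n ≤ n := by linarith
  have h₂ : 8 * (M * Real.log n) ≤ n := by linarith
  constructor
  · linarith
  · nlinarith

theorem stmt_5 (X : ℕ → ℕ → ℝ) (φ φ' : ℕ → ℝ → ℝ) (M₂ a₁ a₂ b₁ b₂ : ℝ)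
    (ha₁ : 0 < a₁) (ha₂ : 0 < a₂)
    (hXorder : ∀ n, 1 ≤ n → ∀ i j : ℕ, i < j → j ≤ n → X n i < X n j)
    (hXmem : ∀ n, 1 ≤ n → ∀ i, i ≤ n → X n i ∈ Set.Icc (-1 : ℝ) 1)
    (hgap : ∀ n : ℕ, 1 ≤ n → ∀ i, 1 ≤ i → i ≤ n →
      a₁ * (n : ℝ) ^ (-b₁) ≤ X n i - X n (i - 1) ∧ X n i - X n (i - 1) ≤ a₂ * (n : ℝ) ^ (-b₂))
    (hφd : ∀ n, ∀ x ∈ Set.Icc (-1 : ℝ) 1, HasDerivAt (φ n) (φ' n x) x)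
    (hφ'bd : ∀ n : ℕ, 1 ≤ n →
      ∀ x ∈ Set.Ioo (-1 + a₁ * (n : ℝ) ^ (-b₁ - 1)) (1 - a₁ * (n : ℝ) ^ (-b₁ - 1)),
        |φ' n x| < M₂ * Real.log n) :
    ∃ N : ℕ, ∀ n : ℕ, N ≤ n → ∀ i, 1 ≤ i → i ≤ n →
      0 < -(1 / (n + 1 : ℝ)) * (∑ j ∈ Finset.range (n + 1),
        1 / (X n i - a₁ * (n : ℝ) ^ (-b₁ - 1) - X n j)) +
        φ' n (X n i - a₁ * (n : ℝ) ^ (-b₁ - 1)) := by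
  obtain ⟨N, hN⟩ := Filter.eventually_atTop.1 (eventually_add_one_mul_mul_log_lt M₂)
  refine ⟨max N 3, fun n hn i hi hin => ?_⟩
  obtain ⟨hT, hlog⟩ := hN n (le_of_max_le_left hn)
  have hn3 : 3 ≤ n := le_of_max_le_right hn
  have hn3' : (3 : ℝ) ≤ n := by exact_mod_cast hn3
  set d : ℝ := a₁ * (n : ℝ) ^ (-b₁) with hd_def
  have hd : 0 < d := by positivity
  have hε : a₁ * (n : ℝ) ^ (-b₁ - 1) = d / n := by
    rw [Real.rpow_sub_one (by positivity), mul_div_assoc]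
  have hbd := hφ'bd n (by omega)
  rw [hε] at hbd ⊢
  have hstep : ∀ i, 1 ≤ i → i ≤ n → d ≤ X n i - X n (i - 1) :=
    fun i hi hin => (hgap n (by omega) i hi hin).1
  have h0 := (hXmem n (by omega) 0 (by omega)).1
  have hsum := sum_one_div_shifted_node_le hd (by omega) hstep hin
  have hdn : 0 < d / n := by positivity
  have hdn3 : d / n ≤ d / 3 := by gcongr
  have hXi : d ≤ X n i - X n 0 := by
    have h := mul_le_sub_of_forall_step_le hstep (Nat.zero_le i) hin
    have hi' : (1 : ℝ) ≤ i := by exact_mod_cast hi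
    rw [Nat.cast_zero, sub_zero] at h
    nlinarith
  have hX1 := (hXmem n (by omega) i hin).2
  have hφ' : -(M₂ * Real.log n) ≤ φ' n (X n i - d / n) := by
    refine le_deriv_right_endpoint (a := -1 + d / n) (by linarith)
      (fun x hx => hφd n x ⟨by linarith [hx.1], by linarith [hx.2]⟩)
      (fun x hx => (abs_lt.1 (hbd x ⟨hx.1, by linarith [hx.2]⟩)).1)
  have hnd : n * d ≤ 2 := by
    have h := mul_le_sub_of_forall_step_le hstep (Nat.zero_le n) le_rfl
    have hXn := (hXmem n (by omega) n le_rfl).2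
    rw [Nat.cast_zero, sub_zero] at h
    linarith
  have hdinv : (n : ℝ) / 2 ≤ 1 / d := by
    rw [div_le_div_iff₀ two_pos hd]
    linarith
  have hS : (n : ℝ) / 2 * (n - 2 * (1 + Real.log n)) ≤
      -∑ j ∈ Finset.range (n + 1), 1 / (X n i - d / n - X n j) := by
    calc (n : ℝ) / 2 * (n - 2 * (1 + Real.log n))
        ≤ 1 / d * (n - 2 * (1 + Real.log n)) := by gcongr
      _ = -((2 * (1 + Real.log n) - n) / d) := by ring
      _ ≤ _ := neg_le_neg hsum
  have hmain : M₂ * Real.log n <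
      -(∑ j ∈ Finset.range (n + 1), 1 / (X n i - d / n - X n j)) / (n + 1 : ℝ) := by
    rw [lt_div_iff₀ (by positivity)]
    linarith
  have heq : -(1 / (n + 1 : ℝ)) * (∑ j ∈ Finset.range (n + 1), 1 / (X n i - d / n - X n j)) =
      -(∑ j ∈ Finset.range (n + 1), 1 / (X n i - d / n - X n j)) / (n + 1 : ℝ) := by ring
  linarith
end

section
/- Under the standing hypotheses, and assuming additionally that the continuous potential U is continuous on [-1,1], set ρ = exp(max_{x∈[-1,1]} U(x) - min_{x∈[-1,1]} U(x)). Then for every ε > 0 there exists N such that for all n > N, the Lebesgue constant satisfies Λ_n ≥ (a_1 / (2 e · n^{b_1+1})) · exp(-(n+1)(δ_n^+ + δ_n^-)) · (ρ · e^{-ε})^{n+1}. -/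
open Filter Finset Set

theorem exists_consecutive_nodes_near {X : ℕ → ℕ → ℝ} {w : ℝ → ℝ}
    (hXorder : ∀ n, 1 ≤ n → ∀ i j : ℕ, i < j → j ≤ n → X n i < X n j)
    (hw_cont : ContinuousOn w (Set.Icc (-1 : ℝ) 1))
    (hw_pos : ∀ t ∈ Set.Icc (-1 : ℝ) 1, 0 < w t)
    (hobeys : ObeysDensity X w) {y τ : ℝ} (hy : y ∈ Set.Icc (-1 : ℝ) 1) (hτ : 0 < τ) :
    ∀ᶠ n : ℕ in atTop, ∃ j, 1 ≤ j ∧ j ≤ n ∧ y - τ ≤ X n (j - 1) ∧ X n j ≤ y + τ := by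
  obtain ⟨hy1, hy2⟩ := hy
  set a := max (-1) (y - τ) with ha
  set b := min 1 (y + τ) with hb
  have hab : a < b := by
    rw [ha, hb, max_lt_iff, lt_min_iff, lt_min_iff]
    refine ⟨⟨?_, ?_⟩, ?_, ?_⟩ <;> linarith
  have ha1 : -1 ≤ a := le_max_left _ _
  have hb1 : b ≤ 1 := min_le_left _ _
  have hsub : Set.Icc a b ⊆ Set.Icc (-1) 1 := Set.Icc_subset_Icc ha1 hb1
  have hc : 0 < ∫ t in a..b, w t := by
    refine intervalIntegral.intervalIntegral_pos_of_pos_on ?_ ?_ hab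
    · exact (hw_cont.mono hsub).intervalIntegrable_of_Icc hab.le
    · exact fun t ht => hw_pos t (hsub (Set.Ioo_subset_Icc_self ht))
  set c := ∫ t in a..b, w t
  have hlim := hobeys a b ha1 hab.le hb1
  have hbig : ∀ᶠ n : ℕ in atTop, 2 / c < (n : ℝ) :=
    tendsto_natCast_atTop_atTop.eventually_gt_atTop _
  filter_upwards [hlim.eventually (lt_mem_nhds (half_lt_self hc)), hbig,
    eventually_ge_atTop 1] with n hn hn2 hn1
  rw [div_lt_iff₀ hc] at hn2
  rw [lt_div_iff₀ (by positivity)] at hn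
  have hcard : (1 : ℝ) <
      (((Finset.range (n + 1)).filter fun i => a ≤ X n i ∧ X n i ≤ b).card : ℝ) := by
    nlinarith
  obtain ⟨i, hi, j, hj, hij⟩ := Finset.one_lt_card.mp (by exact_mod_cast hcard)
  wlog hlt : i < j generalizing i j
  · exact this j hj i hi hij.symm (by omega)
  simp only [Finset.mem_filter, Finset.mem_range] at hi hj
  refine ⟨i + 1, by omega, by omega, ?_, ?_⟩
  · exact (le_max_right _ _).trans hi.2.1
  · have h1 : X n (i + 1) ≤ X n j := by
      rcases Nat.lt_or_ge (i + 1) j with h | h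
      · exact (hXorder n hn1 _ _ h (by omega)).le
      · rw [show i + 1 = j by omega]
    exact h1.trans (hj.2.2.trans (min_le_right _ _))

theorem mul_discretePotential (X : ℕ → ℕ → ℝ) (φ : ℕ → ℝ → ℝ) (n : ℕ) (x : ℝ) :
    (n + 1 : ℝ) * discretePotential X φ n x =
      (n + 1 : ℝ) * φ n x - ∑ i ∈ Finset.range (n + 1), Real.log |x - X n i| := by
  have h : (n + 1 : ℝ) ≠ 0 := by positivity
  simp only [discretePotential, one_div, Real.log_inv, Finset.sum_neg_distrib]
  field_simp
  ring

theorem abs_lagrangeBasis_eq {X : ℕ → ℕ → ℝ} {φ : ℕ → ℝ → ℝ} {n k : ℕ} {x : ℝ}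
    (hk : k ≤ n) (hx : ∀ i ≤ n, x ≠ X n i) :
    |lagrangeBasis X φ n k x| =
      Real.exp (-((n + 1 : ℝ) * discretePotential X φ n x)) / |x - X n k| *
        baryWeight X φ n k := by
  have hpos : ∀ i ∈ Finset.range (n + 1), 0 < |x - X n i| := fun i hi =>
    abs_pos.mpr (sub_ne_zero.mpr (hx i (Nat.lt_succ_iff.mp (Finset.mem_range.mp hi))))
  have hkm : k ∈ Finset.range (n + 1) := Finset.mem_range.mpr (by omega)
  have hk0 := hpos k hkm
  rw [mul_discretePotential, neg_sub, sub_eq_add_neg, Real.exp_add, Real.exp_sum,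
    Finset.prod_congr rfl fun i hi => Real.exp_log (hpos i hi),
    ← Finset.mul_prod_erase _ _ hkm, lagrangeBasis, baryWeight, abs_mul, abs_div,
    Finset.abs_prod, Finset.abs_prod, abs_of_pos (Real.exp_pos _), mul_sub, sub_eq_add_neg,
    Real.exp_add]
  field_simp

theorem baryWeight_eq_exp {X : ℕ → ℕ → ℝ} {φ : ℕ → ℝ → ℝ} {n k : ℕ}
    (hk : ∀ i ≤ n, i ≠ k → X n k ≠ X n i) :
    baryWeight X φ n k = Real.exp ((n + 1 : ℝ) * φ n (X n k) -
      ∑ i ∈ (Finset.range (n + 1)).erase k, Real.log |X n k - X n i|) := by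
  have hpos : ∀ i ∈ (Finset.range (n + 1)).erase k, 0 < |X n k - X n i| := fun i hi => by
    rw [Finset.mem_erase, Finset.mem_range] at hi
    exact abs_pos.mpr (sub_ne_zero.mpr (hk i (by omega) hi.1))
  rw [Real.exp_sub, Real.exp_sum, Finset.prod_congr rfl fun i hi => Real.exp_log (hpos i hi),
    baryWeight]

/-- A tangent-line lower bound for a function whose second derivative is bounded below. -/
theorem tangent_lower_bound {f f' f'' : ℝ → ℝ} {M a b : ℝ}
    (hf : ∀ x ∈ Set.Icc a b, HasDerivAt f (f' x) x)
    (hf' : ∀ x ∈ Set.Icc a b, HasDerivAt f' (f'' x) x)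
    (hM : ∀ x ∈ Set.Icc a b, M ≤ f'' x) {x y : ℝ} (hx : x ∈ Set.Icc a b)
    (hy : y ∈ Set.Icc a b) :
    f x + f' x * (y - x) + M / 2 * (y - x) ^ 2 ≤ f y := by
  set g : ℝ → ℝ := fun t => f t - f x - f' x * (t - x) - M / 2 * (t - x) ^ 2 with hg
  set g' : ℝ → ℝ := fun t => f' t - f' x - M * (t - x) with hg'
  have hgd : ∀ t ∈ Set.Icc a b, HasDerivAt g (g' t) t := fun t ht => by
    have h1 : HasDerivAt (fun t : ℝ => t - x) 1 t := (hasDerivAt_id t).sub_const x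
    have h2 := (((hf t ht).sub_const (f x)).sub (h1.const_mul (f' x))).sub
      ((h1.pow 2).const_mul (M / 2))
    refine h2.congr_deriv ?_
    simp only [hg']
    push_cast
    ring
  have hg'd : ∀ t ∈ Set.Icc a b, HasDerivAt g' (f'' t - M) t := fun t ht => by
    have h1 : HasDerivAt (fun t : ℝ => t - x) 1 t := (hasDerivAt_id t).sub_const x
    refine (((hf' t ht).sub_const (f' x)).sub (h1.const_mul M)).congr_deriv ?_
    ring
  have hmono : MonotoneOn g' (Set.Icc a b) := by
    refine monotoneOn_of_deriv_nonneg (convex_Icc a b)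
      (fun t ht => (hg'd t ht).continuousAt.continuousWithinAt)
      (fun t ht => (hg'd t (interior_subset ht)).differentiableAt.differentiableWithinAt) ?_
    intro t ht
    rw [(hg'd t (interior_subset ht)).deriv]
    linarith [hM t (interior_subset ht)]
  have hg'x : g' x = 0 := by simp [hg']
  have hgx : g x = 0 := by simp [hg]
  have key : 0 ≤ g y := by
    rcases lt_trichotomy x y with h | h | h
    · have hs : Set.Icc x y ⊆ Set.Icc a b := Set.Icc_subset_Icc hx.1 hy.2
      obtain ⟨c, hc, hcd⟩ := exists_hasDerivAt_eq_slope g g' h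
        (fun t ht => (hgd t (hs ht)).continuousAt.continuousWithinAt)
        (fun t ht => hgd t (hs (Set.Ioo_subset_Icc_self ht)))
      have h0 : 0 ≤ g' c := hg'x ▸ hmono hx (hs (Set.Ioo_subset_Icc_self hc)) hc.1.le
      rw [eq_div_iff (sub_pos.mpr h).ne', hgx] at hcd
      nlinarith [mul_nonneg h0 (sub_pos.mpr h).le]
    · rw [← h, hgx]
    · have hs : Set.Icc y x ⊆ Set.Icc a b := Set.Icc_subset_Icc hy.1 hx.2
      obtain ⟨c, hc, hcd⟩ := exists_hasDerivAt_eq_slope g g' h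
        (fun t ht => (hgd t (hs ht)).continuousAt.continuousWithinAt)
        (fun t ht => hgd t (hs (Set.Ioo_subset_Icc_self ht)))
      have h0 : g' c ≤ 0 := hg'x ▸ hmono (hs (Set.Ioo_subset_Icc_self hc)) hx hc.2.le
      rw [eq_div_iff (sub_pos.mpr h).ne', hgx] at hcd
      nlinarith [mul_nonneg (neg_nonneg.mpr h0) (sub_pos.mpr h).le]
  simp only [hg] at key
  linarith

theorem log_abs_le_tangent {u v : ℝ} (h : 0 < u * v) :
    Real.log |v| ≤ Real.log |u| + (v - u) / u := by
  have hu : u ≠ 0 := left_ne_zero_of_mul h.ne'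
  have hv : v ≠ 0 := right_ne_zero_of_mul h.ne'
  have hr : 0 < v / u := by
    rw [show v / u = u * v / u ^ 2 by field_simp]
    positivity
  have h1 := Real.log_le_sub_one_of_pos hr
  rw [← Real.log_abs, abs_div, Real.log_div (abs_ne_zero.mpr hv) (abs_ne_zero.mpr hu)] at h1
  rw [sub_div, div_self hu]
  linarith

/-- At a critical point `z` of the discrete potential the weight of a neighbouring node `X n k`
is at least the potential's exponential at `z`, up to the displayed factor. -/
theorem le_baryWeight {X : ℕ → ℕ → ℝ} {φ : ℕ → ℝ → ℝ} {n k : ℕ} {z φz M : ℝ}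
    (hk : k ≤ n) (hz : z ≠ X n k) (hφ : HasDerivAt (φ n) φz z)
    (hside : ∀ i ≤ n, i ≠ k → 0 < (z - X n i) * (X n k - X n i))
    (hcrit : deriv (discretePotential X φ n) z = 0)
    (htan : φ n z + φz * (X n k - z) + M / 2 * (X n k - z) ^ 2 ≤ φ n (X n k)) :
    Real.exp ((n + 1 : ℝ) * discretePotential X φ n z) * |z - X n k| *
      Real.exp (-1 + (n + 1 : ℝ) * (M / 2 * (X n k - z) ^ 2)) ≤ baryWeight X φ n k := by
  have hkm : k ∈ Finset.range (n + 1) := Finset.mem_range.mpr (by omega)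
  have hzne : ∀ i ∈ Finset.range (n + 1), z - X n i ≠ 0 := fun i hi => by
    rw [Finset.mem_range] at hi
    by_cases h : i = k
    · rw [h]; exact sub_ne_zero.mpr hz
    · exact left_ne_zero_of_mul (hside i (by omega) h).ne'
  have hzk := hzne k hkm
  have hderiv : (n + 1 : ℝ) * φz = ∑ i ∈ Finset.range (n + 1), 1 / (z - X n i) := by
    have h1 : HasDerivAt (fun x => (n + 1 : ℝ) * φ n x -
        ∑ i ∈ Finset.range (n + 1), Real.log |x - X n i|)
        ((n + 1 : ℝ) * φz - ∑ i ∈ Finset.range (n + 1), 1 / (z - X n i)) z := by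
      refine (hφ.const_mul _).sub (HasDerivAt.fun_sum fun i hi => ?_)
      simp only [Real.log_abs]
      exact ((hasDerivAt_id z).sub_const (X n i)).log (hzne i hi)
    have h2 : deriv (fun x => (n + 1 : ℝ) * discretePotential X φ n x) z = 0 := by
      rw [deriv_const_mul_field, hcrit, mul_zero]
    rw [funext fun x => mul_discretePotential X φ n x, h1.deriv] at h2
    linarith
  have hlog : ∑ i ∈ (Finset.range (n + 1)).erase k, Real.log |X n k - X n i| ≤
      ∑ i ∈ (Finset.range (n + 1)).erase k,
        (Real.log |z - X n i| + (X n k - z) * (1 / (z - X n i))) := by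
    refine Finset.sum_le_sum fun i hi => ?_
    rw [Finset.mem_erase, Finset.mem_range] at hi
    refine (log_abs_le_tangent (hside i (by omega) hi.1)).trans_eq ?_
    ring
  rw [Finset.sum_add_distrib, ← Finset.mul_sum] at hlog
  have hs1 := Finset.add_sum_erase (Finset.range (n + 1)) (fun i => Real.log |z - X n i|) hkm
  have hs2 := Finset.add_sum_erase (Finset.range (n + 1)) (fun i => 1 / (z - X n i)) hkm
  have hone : (X n k - z) * (1 / (z - X n k)) = -1 := by
    field_simp
    ring
  have hne : ∀ i ≤ n, i ≠ k → X n k ≠ X n i := fun i hi hik =>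
    sub_ne_zero.mp (right_ne_zero_of_mul (hside i hi hik).ne')
  rw [baryWeight_eq_exp hne]
  rw [← Real.exp_log (abs_pos.mpr hzk)]
  rw [← Real.exp_add, ← Real.exp_add, Real.exp_le_exp, mul_discretePotential]
  have htan' := mul_le_mul_of_nonneg_left htan (by positivity : (0 : ℝ) ≤ n + 1)
  have hlin : (n + 1 : ℝ) * (φz * (X n k - z)) =
      -1 + (X n k - z) * ∑ i ∈ (Finset.range (n + 1)).erase k, 1 / (z - X n i) := by
    rw [← mul_assoc, hderiv, ← hs2, add_mul, mul_comm (1 / (z - X n k)), hone]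
    ring
  nlinarith

theorem continuousOn_lebesgueFun {X : ℕ → ℕ → ℝ} {φ : ℕ → ℝ → ℝ} {n : ℕ} {s : Set ℝ}
    (hφ : ContinuousOn (φ n) s) : ContinuousOn (lebesgueFun X φ n) s := by
  unfold lebesgueFun lagrangeBasis
  fun_prop

theorem abs_lagrangeBasis_le_lebesgueFun {X : ℕ → ℕ → ℝ} {φ : ℕ → ℝ → ℝ} {n k : ℕ} (hk : k ≤ n)
    (x : ℝ) : |lagrangeBasis X φ n k x| ≤ lebesgueFun X φ n x :=
  Finset.single_le_sum (f := fun k => |lagrangeBasis X φ n k x|) (fun _ _ => abs_nonneg _)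
    (Finset.mem_range.mpr (by omega))

/-- A point strictly between two consecutive nodes lies at least half their gap away from one of
them, and on the same side of all other nodes as that one. -/
theorem exists_far_neighbour {x : ℕ → ℝ} {n j : ℕ} {z : ℝ}
    (hx : ∀ i j : ℕ, i < j → j ≤ n → x i < x j) (hj : 1 ≤ j) (hjn : j ≤ n)
    (hz : z ∈ Set.Ioo (x (j - 1)) (x j)) :
    ∃ k ≤ n, x k ∈ Set.Icc (x (j - 1)) (x j) ∧ (x j - x (j - 1)) / 2 ≤ |z - x k| ∧
      ∀ i ≤ n, i ≠ k → 0 < (z - x i) * (x k - x i) := by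
  have hle : ∀ i j : ℕ, i ≤ j → j ≤ n → x i ≤ x j := fun i j hij hjn => by
    rcases hij.lt_or_eq with h | h
    · exact (hx i j h hjn).le
    · rw [h]
  obtain ⟨hz1, hz2⟩ := hz
  have hlt := hz1.trans hz2
  rcases le_total ((x j - x (j - 1)) / 2) (z - x (j - 1)) with h | h
  · refine ⟨j - 1, by omega, ⟨le_rfl, hlt.le⟩, h.trans (le_abs_self _), fun i hi hik => ?_⟩
    rcases Nat.lt_or_ge i j with hij | hij
    · have := hx i (j - 1) (by omega) (by omega)
      exact mul_pos (by linarith) (by linarith)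
    · have := hle j i hij hi
      exact mul_pos_of_neg_of_neg (by linarith) (by linarith)
  · refine ⟨j, hjn, ⟨hlt.le, le_rfl⟩, le_trans (by linarith) (neg_le_abs _), fun i hi hik => ?_⟩
    rcases Nat.lt_or_ge i j with hij | hij
    · have := hle i (j - 1) (by omega) (by omega)
      exact mul_pos (by linarith) (by linarith)
    · have := hx j i (by omega) hi
      exact mul_pos_of_neg_of_neg (by linarith) (by linarith)

theorem stmt_11 (X : ℕ → ℕ → ℝ) (w : ℝ → ℝ) (φ : ℕ → ℝ → ℝ) (φl : ℝ → ℝ)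
    (φ' φ'' : ℕ → ℝ → ℝ) (M M₂ a₁ a₂ b₁ b₂ : ℝ)
    (ζ : ℕ → ℕ → ℝ) (δm δp : ℕ → ℝ) (ρ : ℝ)
    (hXorder : ∀ n, 1 ≤ n → ∀ i j : ℕ, i < j → j ≤ n → X n i < X n j)
    (hXmem : ∀ n, 1 ≤ n → ∀ i, i ≤ n → X n i ∈ Set.Icc (-1 : ℝ) 1)
    (hw_cont : ContinuousOn w (Set.Icc (-1 : ℝ) 1))
    (hw_pos : ∀ t ∈ Set.Icc (-1 : ℝ) 1, 0 < w t)
    (hw_int : (∫ t in (-1 : ℝ)..1, w t) = 1)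
    (hobeys : ObeysDensity X w)
    (hφd1 : ∀ n, ∀ x ∈ Set.Icc (-1 : ℝ) 1, HasDerivAt (φ n) (φ' n x) x)
    (hφd2 : ∀ n, ∀ x ∈ Set.Icc (-1 : ℝ) 1, HasDerivAt (φ' n) (φ'' n x) x)
    (hφ''cont : ∀ n, ContinuousOn (φ'' n) (Set.Icc (-1 : ℝ) 1))
    (hM : ∀ n, ∀ x ∈ Set.Icc (-1 : ℝ) 1, M ≤ φ'' n x)
    (hφunif : TendstoUniformlyOn φ φl Filter.atTop (Set.Icc (-1 : ℝ) 1))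
    (ha₁ : 0 < a₁) (ha₂ : 0 < a₂)
    (hgap : ∀ n : ℕ, 1 ≤ n → ∀ i, 1 ≤ i → i ≤ n →
      a₁ * (n : ℝ) ^ (-b₁) ≤ X n i - X n (i - 1) ∧ X n i - X n (i - 1) ≤ a₂ * (n : ℝ) ^ (-b₂))
    (hφ'bd : ∀ n : ℕ, 1 ≤ n →
      ∀ x ∈ Set.Ioo (-1 + a₁ * (n : ℝ) ^ (-b₁ - 1)) (1 - a₁ * (n : ℝ) ^ (-b₁ - 1)),
        |φ' n x| < M₂ * Real.log n)
    (hζmem : ∀ n : ℕ, 1 ≤ n → ∀ i, 1 ≤ i → i ≤ n → ζ n i ∈ Set.Ioo (X n (i - 1)) (X n i))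
    (hζcrit : ∀ n : ℕ, 1 ≤ n → ∀ i, 1 ≤ i → i ≤ n → deriv (discretePotential X φ n) (ζ n i) = 0)
    (hδm : ∀ n, 0 ≤ δm n) (hδp : ∀ n, 0 ≤ δp n)
    (hδ : ∀ᶠ n : ℕ in Filter.atTop, ∀ i, 1 ≤ i → i ≤ n →
      -δm n ≤ discretePotential X φ n (ζ n i) - continuousPotential w φl (ζ n i) ∧
        discretePotential X φ n (ζ n i) - continuousPotential w φl (ζ n i) ≤ δp n)
    (hUcont : ContinuousOn (continuousPotential w φl) (Set.Icc (-1 : ℝ) 1))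
    (hρ : ρ = Real.exp (sSup (continuousPotential w φl '' Set.Icc (-1 : ℝ) 1) -
      sInf (continuousPotential w φl '' Set.Icc (-1 : ℝ) 1)))
    :
    ∀ ε : ℝ, 0 < ε → ∃ N : ℕ, ∀ n : ℕ, N < n →
      a₁ / (2 * Real.exp 1 * (n : ℝ) ^ (b₁ + 1)) *
            Real.exp (-(n + 1 : ℝ) * (δp n + δm n)) * (ρ * Real.exp (-ε)) ^ (n + 1) ≤
        sSup (lebesgueFun X φ n '' Set.Icc (-1 : ℝ) 1) := by
  intro ε hε
  set U := continuousPotential w φl with hU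
  have hne : (Set.Icc (-1 : ℝ) 1).Nonempty := ⟨0, by norm_num⟩
  obtain ⟨p, hp, hpmax⟩ := isCompact_Icc.exists_sSup_image_eq hne hUcont
  obtain ⟨q, hq, hqmin⟩ := isCompact_Icc.exists_sInf_image_eq hne hUcont
  rw [hpmax, hqmin] at hρ
  have hε3 : 0 < ε / 3 := by positivity
  obtain ⟨τ₁, hτ₁, hUp⟩ := Metric.continuousOn_iff.mp hUcont p hp (ε / 3) hε3
  obtain ⟨τ₂, hτ₂, hUq⟩ := Metric.continuousOn_iff.mp hUcont q hq (ε / 3) hε3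
  obtain ⟨τ₃, hτ₃, hMτ⟩ : ∃ τ > 0, |M| / 2 * (2 * τ) ^ 2 ≤ ε / 3 := by
    refine ⟨min 1 (ε / (6 * (|M| + 1))), by positivity, ?_⟩
    set τ := min 1 (ε / (6 * (|M| + 1)))
    have h0 : 0 < τ := by positivity
    have h1 : τ ≤ 1 := min_le_left _ _
    have h2 : τ * (6 * (|M| + 1)) ≤ ε := (le_div_iff₀ (by positivity)).mp (min_le_right _ _)
    nlinarith [mul_nonneg (abs_nonneg M) h0.le,
      mul_nonneg (mul_nonneg (abs_nonneg M) h0.le) (sub_nonneg.mpr h1)]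
  have hE1 := exists_consecutive_nodes_near hXorder hw_cont hw_pos hobeys hp
    (show 0 < min (τ₁ / 2) τ₃ by positivity)
  have hE2 := exists_consecutive_nodes_near hXorder hw_cont hw_pos hobeys hq
    (half_pos hτ₂)
  obtain ⟨N, hN⟩ := eventually_atTop.mp
    (hE1.and (hE2.and (hδ.and (eventually_ge_atTop 2))))
  refine ⟨N, fun n hn => ?_⟩
  obtain ⟨⟨j, hj1, hjn, hjl, hjr⟩, ⟨l, hl1, hln, hll, hlr⟩, hδn, hn2⟩ := hN n hn.le
  have hn1 : 1 ≤ n := by omega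
  have hτa := min_le_left (τ₁ / 2) τ₃
  have hτb := min_le_right (τ₁ / 2) τ₃
  have hz := hζmem n hn1 j hj1 hjn
  have hy := hζmem n hn1 l hl1 hln
  have hzI : ζ n j ∈ Set.Icc (-1 : ℝ) 1 :=
    ⟨(hXmem n hn1 (j - 1) (by omega)).1.trans hz.1.le, hz.2.le.trans (hXmem n hn1 j hjn).2⟩
  have hyI : ζ n l ∈ Set.Icc (-1 : ℝ) 1 :=
    ⟨(hXmem n hn1 (l - 1) (by omega)).1.trans hy.1.le, hy.2.le.trans (hXmem n hn1 l hln).2⟩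
  obtain ⟨hz1, hz2⟩ := hz
  obtain ⟨hy1, hy2⟩ := hy
  obtain ⟨k, hk, hkI, hkfar, hkside⟩ :=
    exists_far_neighbour (hXorder n hn1) hj1 hjn ⟨hz1, hz2⟩
  have hgapj := (hgap n hn1 j hj1 hjn).1
  have hnb : 0 < (n : ℝ) ^ (-b₁) := by positivity
  have hdist : a₁ * (n : ℝ) ^ (-b₁) / 2 ≤ |ζ n j - X n k| := by linarith
  have hzk : ζ n j ≠ X n k := fun h => by
    rw [h, sub_self, abs_zero] at hdist
    have : 0 < a₁ * (n : ℝ) ^ (-b₁) := by positivity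
    linarith
  have hW := le_baryWeight hk hzk (hφd1 n _ hzI) hkside (hζcrit n hn1 j hj1 hjn)
    (tangent_lower_bound (hφd1 n) (hφd2 n) (hM n) hzI (hXmem n hn1 k hk))
  have hsq : -(ε / 3) ≤ M / 2 * (X n k - ζ n j) ^ 2 := by
    have h1 : (X n k - ζ n j) ^ 2 ≤ (2 * τ₃) ^ 2 := by
      refine sq_le_sq' ?_ ?_ <;> linarith [hkI.1, hkI.2]
    have h2 := mul_le_mul_of_nonneg_left h1 (show 0 ≤ |M| / 2 by positivity)
    have h3 := mul_le_mul_of_nonneg_right (neg_abs_le M) (sq_nonneg (X n k - ζ n j))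
    linarith
  have hyne : ∀ i ≤ n, ζ n l ≠ X n i := fun i hi h => by
    rcases Nat.lt_or_ge i l with hil | hil
    · rcases (show i ≤ l - 1 by omega).lt_or_eq with h' | h'
      · linarith [hXorder n hn1 _ _ h' (by omega)]
      · rw [h'] at h; linarith
    · rcases hil.lt_or_eq with h' | h'
      · linarith [hXorder n hn1 _ _ h' hi]
      · rw [← h'] at h; linarith
  have hR := abs_lagrangeBasis_eq (φ := φ) hk hyne
  have hUz : U p - ε / 3 ≤ U (ζ n j) := by
    have h := hUp _ hzI (by rw [Real.dist_eq, abs_lt]; constructor <;> linarith)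
    rw [Real.dist_eq, abs_lt] at h
    linarith
  have hUy : U (ζ n l) ≤ U q + ε / 3 := by
    have h := hUq _ hyI (by rw [Real.dist_eq, abs_lt]; constructor <;> linarith)
    rw [Real.dist_eq, abs_lt] at h
    linarith
  have hδz := (hδn j hj1 hjn).1
  have hδy := (hδn l hl1 hln).2
  have hyk : |ζ n l - X n k| ≤ 2 := by
    have h := hXmem n hn1 k hk
    rw [abs_le]
    constructor <;> linarith [hyI.1, hyI.2, h.1, h.2]
  have hyk0 : 0 < |ζ n l - X n k| := abs_pos.mpr (sub_ne_zero.mpr (hyne k hk))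
  have hconst : a₁ / (2 * Real.exp 1 * (n : ℝ) ^ (b₁ + 1)) ≤
      a₁ * (n : ℝ) ^ (-b₁) / 2 * Real.exp (-1) / 2 := by
    have hn0 : (0 : ℝ) < n := by positivity
    have hn2' : (2 : ℝ) ≤ n := by exact_mod_cast hn2
    rw [Real.rpow_add hn0, Real.rpow_one, Real.rpow_neg hn0.le, Real.exp_neg]
    have he := Real.exp_pos 1
    have hb := Real.rpow_pos_of_pos hn0 b₁
    rw [div_le_iff₀ (by positivity)]
    field_simp
    linarith
  have hpow : Real.exp (-(n + 1 : ℝ) * (δp n + δm n)) * (ρ * Real.exp (-ε)) ^ (n + 1) =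
      Real.exp ((n + 1 : ℝ) * (U p - U q - ε - δp n - δm n)) := by
    rw [hρ, ← Real.exp_add, ← Real.exp_nat_mul, ← Real.exp_add]
    push_cast
    ring_nf
  calc
    _ = a₁ / (2 * Real.exp 1 * (n : ℝ) ^ (b₁ + 1)) *
        Real.exp ((n + 1 : ℝ) * (U p - U q - ε - δp n - δm n)) := by rw [mul_assoc, hpow]
    _ ≤ a₁ * (n : ℝ) ^ (-b₁) / 2 * Real.exp (-1) / 2 *
        Real.exp (-((n + 1 : ℝ) * discretePotential X φ n (ζ n l)) +
          (n + 1 : ℝ) * discretePotential X φ n (ζ n j) +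
          (n + 1 : ℝ) * (M / 2 * (X n k - ζ n j) ^ 2)) := by
      refine mul_le_mul hconst (Real.exp_le_exp.mpr ?_) (Real.exp_pos _).le (by positivity)
      rw [← mul_neg, ← mul_add, ← mul_add]
      exact mul_le_mul_of_nonneg_left (by linarith) (by positivity)
    _ = Real.exp (-((n + 1 : ℝ) * discretePotential X φ n (ζ n l))) / 2 *
        (Real.exp ((n + 1 : ℝ) * discretePotential X φ n (ζ n j)) *
          (a₁ * (n : ℝ) ^ (-b₁) / 2) *
          Real.exp (-1 + (n + 1 : ℝ) * (M / 2 * (X n k - ζ n j) ^ 2))) := by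
      simp only [Real.exp_add]
      ring
    _ ≤ Real.exp (-((n + 1 : ℝ) * discretePotential X φ n (ζ n l))) / |ζ n l - X n k| *
        baryWeight X φ n k := by
      refine mul_le_mul ?_ (le_trans ?_ hW) (by positivity) (by positivity)
      · gcongr
      · gcongr
    _ = |lagrangeBasis X φ n k (ζ n l)| := hR.symm
    _ ≤ lebesgueFun X φ n (ζ n l) := abs_lagrangeBasis_le_lebesgueFun hk _
    _ ≤ _ := le_csSup (isCompact_Icc.bddAbove_image (continuousOn_lebesgueFun
        fun x hx => (hφd1 n x hx).continuousAt.continuousWithinAt)) ⟨_, hyI, rfl⟩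
end

section
/- Let u : ℝ → ℝ be convex and differentiable on an open interval I, let ζ₁ < x₀ < ζ₂ be points of I, and let c > 0. Suppose the tangent-line drops are equal, i.e. u'(ζ₁) = -c/(x₀ - ζ₁) and u'(ζ₂) = c/(ζ₂ - x₀). Set λ = (x₀ - ζ₁)/(ζ₂ - ζ₁). Then for every x ∈ I, u(x) ≥ λ · u(ζ₁) + (1 - λ) · u(ζ₂) - c. -/
open Filter Finset Set

/-- A convex function lies above each of its tangent lines. -/
lemma ConvexOn.tangent_line_le {s : Set ℝ} {f : ℝ → ℝ} (hf : ConvexOn ℝ s f) {x y : ℝ}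
    (hx : x ∈ s) (hy : y ∈ s) (hd : DifferentiableAt ℝ f x) :
    f x + deriv f x * (y - x) ≤ f y := by
  rcases lt_trichotomy x y with h | rfl | h
  · have key := hf.deriv_le_slope hx hy h hd
    rw [slope_def_field, le_div_iff₀ (sub_pos.2 h)] at key
    linarith
  · simp
  · have key := hf.slope_le_deriv hy hx h hd
    rw [slope_def_field, div_le_iff₀ (sub_pos.2 h)] at key
    linarith

theorem stmt_12 (a b : ℝ) (u : ℝ → ℝ) (ζ₁ x₀ ζ₂ c lam : ℝ)
    (hconv : ConvexOn ℝ (Set.Ioo a b) u)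
    (hdiff : ∀ x ∈ Set.Ioo a b, DifferentiableAt ℝ u x)
    (hζ₁ : ζ₁ ∈ Set.Ioo a b) (hx₀ : x₀ ∈ Set.Ioo a b) (hζ₂ : ζ₂ ∈ Set.Ioo a b)
    (h₁ : ζ₁ < x₀) (h₂ : x₀ < ζ₂) (hc : 0 < c)
    (hd₁ : deriv u ζ₁ = -c / (x₀ - ζ₁))
    (hd₂ : deriv u ζ₂ = c / (ζ₂ - x₀))
    (hlam : lam = (x₀ - ζ₁) / (ζ₂ - ζ₁)) :
    ∀ x ∈ Set.Ioo a b, lam * u ζ₁ + (1 - lam) * u ζ₂ - c ≤ u x := by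
  intro x hx
  have hp : 0 < x₀ - ζ₁ := sub_pos.2 h₁
  have hq : 0 < ζ₂ - x₀ := sub_pos.2 h₂
  have hr : 0 < ζ₂ - ζ₁ := by linarith
  have hlam' : 1 - lam = (ζ₂ - x₀) / (ζ₂ - ζ₁) := by
    rw [hlam]
    field_simp
    ring
  have t₁ := hconv.tangent_line_le hζ₁ hx (hdiff _ hζ₁)
  have t₂ := hconv.tangent_line_le hζ₂ hx (hdiff _ hζ₂)
  have e₁ : lam * deriv u ζ₁ = -c / (ζ₂ - ζ₁) := by
    rw [hlam, hd₁]
    field_simp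
  have e₂ : (1 - lam) * deriv u ζ₂ = c / (ζ₂ - ζ₁) := by
    rw [hlam', hd₂]
    field_simp
  have hlam_nonneg : 0 ≤ lam := hlam ▸ (div_pos hp hr).le
  have hlam'_nonneg : 0 ≤ 1 - lam := hlam' ▸ (div_pos hq hr).le
  calc lam * u ζ₁ + (1 - lam) * u ζ₂ - c
      = lam * u ζ₁ + (1 - lam) * u ζ₂ + -c / (ζ₂ - ζ₁) * (x - ζ₁)
          + c / (ζ₂ - ζ₁) * (x - ζ₂) := by
        field_simp
        ring
    _ = lam * (u ζ₁ + deriv u ζ₁ * (x - ζ₁)) + (1 - lam) * (u ζ₂ + deriv u ζ₂ * (x - ζ₂)) := by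
        rw [← e₁, ← e₂]
        ring
    _ ≤ lam * u x + (1 - lam) * u x := by gcongr
    _ = u x := by ring
end

section
/- Under the standing hypotheses, and assuming additionally that the continuous potential U is identically equal to a constant C on [-1,1], for all sufficiently large n and every index 0 < i < n, the Lagrange basis function satisfies |R_i^{(n)}(x)| ≤ exp((n+1)(δ_n^- + δ_n^+) + 1) for all x ∈ (x_{i-1}^{(n)}, x_{i+1}^{(n)}). -/
open Filter Finset Set

/-- A function on `(a, b)` with antitone derivative lies below its tangent lines. -/
lemma le_tangent_of_antitoneOn_deriv {L L' : ℝ → ℝ} {a b : ℝ}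
    (hL : ∀ x ∈ Set.Ioo a b, HasDerivAt L (L' x) x) (hanti : AntitoneOn L' (Set.Ioo a b))
    {x y : ℝ} (hx : x ∈ Set.Ioo a b) (hy : y ∈ Set.Ioo a b) :
    L y ≤ L x + L' x * (y - x) := by
  have hsub : ∀ u ∈ Set.Ioo a b, ∀ v ∈ Set.Ioo a b, Set.Icc u v ⊆ Set.Ioo a b :=
    fun u hu v hv t ht => ⟨hu.1.trans_le ht.1, ht.2.trans_lt hv.2⟩
  have mvt : ∀ u ∈ Set.Ioo a b, ∀ v ∈ Set.Ioo a b, u < v →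
      ∃ c ∈ Set.Ioo u v, L' c * (v - u) = L v - L u := by
    intro u hu v hv huv
    obtain ⟨c, hc, hceq⟩ := exists_hasDerivAt_eq_slope L L' huv
      (fun t ht => (hL t (hsub u hu v hv ht)).continuousAt.continuousWithinAt)
      (fun t ht => hL t (hsub u hu v hv (Set.Ioo_subset_Icc_self ht)))
    refine ⟨c, hc, ?_⟩
    rw [hceq]
    have : v - u ≠ 0 := (sub_pos.2 huv).ne'
    field_simp
  rcases lt_trichotomy x y with h | h | h
  · obtain ⟨c, hc, hceq⟩ := mvt x hx y hy h
    have := hanti hx (hsub x hx y hy (Set.Ioo_subset_Icc_self hc)) hc.1.le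
    nlinarith [mul_le_mul_of_nonneg_right this (sub_pos.2 h).le]
  · subst h; simp
  · obtain ⟨c, hc, hceq⟩ := mvt y hy x hx h
    have := hanti (hsub y hy x hx (Set.Ioo_subset_Icc_self hc)) hx hc.2.le
    nlinarith [mul_le_mul_of_nonneg_right this (sub_pos.2 h).le]

/-- Upper bound to the right of a zero `c` where a function below its tangents has
nonnegative slope. -/
lemma le_add_one_of_tangent_of_nonneg {L L' : ℝ → ℝ} {S : Set ℝ} {p c q D : ℝ}
    (htan : ∀ x ∈ S, ∀ y ∈ S, L y ≤ L x + L' x * (y - x))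
    (hp : p ∈ S) (hc : c ∈ S) (hq : q ∈ S) (hpc : p < c) (hcq : c < q) (hD : 0 ≤ D)
    (hLc : L c = 0) (hLp : L' p = 1 / (c - p)) (hLq : L' q = -(1 / (q - c)))
    (hqp : (L q + Real.log (q - c)) - (L p + Real.log (c - p)) ≤ D)
    (hs : 0 ≤ L' c) {y : ℝ} (hy : y ∈ S) : L y ≤ D + 1 := by
  have h1 : 0 < c - p := sub_pos.2 hpc
  have h2 : 0 < q - c := sub_pos.2 hcq
  have hyc := htan c hc y hy
  have hpc' := htan c hc p hp
  have hqc' := htan c hc q hq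
  have hcp' := htan p hp c hc
  have hyq := htan q hq y hy
  rw [hLp, one_div, inv_mul_cancel₀ h1.ne', hLc] at hcp'
  rw [hLc] at hyc hpc' hqc'
  rcases le_or_gt y c with hy0 | hy0
  · nlinarith [mul_nonneg hs (sub_nonneg.2 hy0)]
  have hLp0 : L p ≤ 0 := by nlinarith [mul_nonneg hs h1.le]
  have hyq1 : L y ≤ L q + 1 := by
    have : (q - y) / (q - c) ≤ 1 := (div_le_one h2).2 (by linarith)
    have e : L' q * (y - q) = (q - y) / (q - c) := by rw [hLq]; ring
    linarith
  rcases le_or_gt (c - p) (q - c) with h | h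
  · have := Real.log_le_log h1 h
    linarith
  · have hq1 : L' c * (q - c) ≤ 1 := by
      nlinarith [mul_le_mul_of_nonneg_left h.le hs]
    rcases le_or_gt y q with hyq0 | hyq0
    · nlinarith [mul_le_mul_of_nonneg_left hyq0 hs]
    · have : L' q * (y - q) ≤ 0 := by
        rw [hLq]
        have := mul_nonneg (one_div_pos.2 h2).le (sub_pos.2 hyq0).le
        linarith
      linarith

/-- Upper bound for a function below its tangents which vanishes at `c`, whose slopes at `p` and
`q` match those of `-log |x - c|`. -/
lemma le_add_one_of_tangent {L L' : ℝ → ℝ} {S : Set ℝ} {p c q D : ℝ}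
    (htan : ∀ x ∈ S, ∀ y ∈ S, L y ≤ L x + L' x * (y - x))
    (hp : p ∈ S) (hc : c ∈ S) (hq : q ∈ S) (hpc : p < c) (hcq : c < q)
    (hLc : L c = 0) (hLp : L' p = 1 / (c - p)) (hLq : L' q = -(1 / (q - c)))
    (hpq : |(L q + Real.log (q - c)) - (L p + Real.log (c - p))| ≤ D)
    {y : ℝ} (hy : y ∈ S) : L y ≤ D + 1 := by
  have hD : 0 ≤ D := (abs_nonneg _).trans hpq
  obtain ⟨hl, hr⟩ := abs_le.1 hpq
  rcases le_total 0 (L' c) with hs | hs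
  · exact le_add_one_of_tangent_of_nonneg htan hp hc hq hpc hcq hD hLc hLp hLq hr hs hy
  · have key := le_add_one_of_tangent_of_nonneg (L := fun x => L (-x)) (L' := fun x => -L' (-x))
      (S := {x | -x ∈ S}) (p := -q) (c := -c) (q := -p) (D := D) (y := -y)
    simp only [Set.mem_ofPred_eq, neg_neg] at key
    refine key ?_ hq hc hp (by linarith) (by linarith) hD hLc ?_ ?_ ?_ (by linarith) hy
    · intro x hx z hz
      have := htan _ hx _ hz
      linarith
    · rw [hLq, neg_neg]; ring
    · rw [hLp]; ring
    · rw [show -p - -c = c - p by ring, show -c - -q = q - c by ring]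
      linarith

/-- A node family with positive continuous density is eventually so dense that the sums
`∑ 1 / (x - x_k)²`, even with one term removed, dominate any multiple of `n + 1`. -/
lemma eventually_mul_le_sum_inv_sq (X : ℕ → ℕ → ℝ) (w : ℝ → ℝ)
    (hw_cont : ContinuousOn w (Set.Icc (-1 : ℝ) 1))
    (hw_pos : ∀ t ∈ Set.Icc (-1 : ℝ) 1, 0 < w t) (hobeys : ObeysDensity X w) (B : ℝ) :
    ∀ᶠ n : ℕ in atTop, ∀ i, ∀ x ∈ Set.Icc (-1 : ℝ) 1,
      (∀ k ∈ (Finset.range (n + 1)).erase i, x ≠ X n k) →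
      (n + 1 : ℝ) * B ≤ ∑ k ∈ (Finset.range (n + 1)).erase i, ((x - X n k) ^ 2)⁻¹ := by
  obtain ⟨t₀, ht₀, hmin⟩ := isCompact_Icc.exists_isMinOn
    (Set.nonempty_Icc.2 (by norm_num : (-1 : ℝ) ≤ 1)) hw_cont
  set m := w t₀ with hm
  have hm0 : 0 < m := hw_pos t₀ ht₀
  obtain ⟨K, hK⟩ := exists_nat_gt (max 1 (8 * B / m))
  have hK1 : (1 : ℝ) < K := (le_max_left _ _).trans_lt hK
  have hKB : 8 * B / m < K := (le_max_right _ _).trans_lt hK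
  have hK0 : (0 : ℝ) < K := by linarith
  set η : ℝ := 2 / K with hη
  have hη0 : 0 < η := by positivity
  have hηK : η * K = 2 := by rw [hη]; field_simp
  have hcell : ∀ᶠ n : ℕ in atTop, ∀ j ∈ Finset.range K, (n + 1 : ℝ) * (m * η / 2) ≤
      (((Finset.range (n + 1)).filter fun i =>
        -1 + j * η ≤ X n i ∧ X n i ≤ -1 + (j + 1) * η).card : ℝ) := by
    rw [Filter.eventually_all_finset]
    intro j hj
    have hjK : ((j : ℝ) + 1) ≤ K := by exact_mod_cast Finset.mem_range.1 hj
    have hl : -1 ≤ -1 + (j : ℝ) * η := by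
      have : 0 ≤ (j : ℝ) * η := by positivity
      linarith
    have hlr : -1 + (j : ℝ) * η ≤ -1 + ((j : ℝ) + 1) * η := by nlinarith
    have hr : -1 + ((j : ℝ) + 1) * η ≤ 1 := by nlinarith
    have hlim := hobeys _ _ hl hlr hr
    have hint : m * η / 2 < ∫ t in (-1 + (j : ℝ) * η)..(-1 + ((j : ℝ) + 1) * η), w t := by
      have hsub : Set.Icc (-1 + (j : ℝ) * η) (-1 + ((j : ℝ) + 1) * η) ⊆ Set.Icc (-1) 1 :=
        Set.Icc_subset_Icc hl hr
      have h1 : ∫ t in (-1 + (j : ℝ) * η)..(-1 + ((j : ℝ) + 1) * η), m ≤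
          ∫ t in (-1 + (j : ℝ) * η)..(-1 + ((j : ℝ) + 1) * η), w t :=
        intervalIntegral.integral_mono_on hlr intervalIntegrable_const
          ((hw_cont.mono hsub).intervalIntegrable_of_Icc hlr) (fun t ht => hmin (hsub ht))
      rw [intervalIntegral.integral_const, smul_eq_mul] at h1
      have h2 : 0 < m * η := by positivity
      nlinarith
    filter_upwards [hlim.eventually (lt_mem_nhds hint)] with n hn
    have hn1 : (0 : ℝ) < n + 1 := by positivity
    rw [lt_div_iff₀ hn1] at hn
    linarith
  obtain ⟨N, hN⟩ := exists_nat_gt (4 / (m * η))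
  filter_upwards [hcell, Filter.eventually_ge_atTop N] with n hn hNn i x hx hne
  have hn1 : (0 : ℝ) < n + 1 := by positivity
  have hbig : 1 ≤ (n + 1 : ℝ) * (m * η / 4) := by
    have h1 : (N : ℝ) ≤ n := by exact_mod_cast hNn
    have h2 : 4 / (m * η) < n + 1 := by linarith
    rw [div_lt_iff₀ (by positivity)] at h2
    linarith
  obtain ⟨j, hj, hxl, hxr⟩ : ∃ j ∈ Finset.range K, -1 + j * η ≤ x ∧ x ≤ -1 + ((j : ℝ) + 1) * η := by
    rcases eq_or_lt_of_le hx.2 with rfl | hx1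
    · have hKpos : 1 < K := by exact_mod_cast hK1
      refine ⟨K - 1, Finset.mem_range.2 (by omega), ?_, ?_⟩ <;>
        rw [Nat.cast_sub hKpos.le] <;> push_cast <;> nlinarith
    · have h0 : 0 ≤ (x + 1) / η := div_nonneg (by linarith [hx.1]) hη0.le
      have h1 := Nat.floor_le h0
      have h2 := Nat.lt_floor_add_one ((x + 1) / η)
      rw [le_div_iff₀ hη0] at h1
      rw [div_lt_iff₀ hη0] at h2
      refine ⟨⌊(x + 1) / η⌋₊, ?_, by linarith, by linarith⟩
      rw [Finset.mem_range, Nat.floor_lt h0, div_lt_iff₀ hη0]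
      linarith
  set F := (Finset.range (n + 1)).filter fun i =>
        -1 + j * η ≤ X n i ∧ X n i ≤ -1 + ((j : ℝ) + 1) * η with hF
  have hFc := hn j hj
  have hterm : ∀ k ∈ F.erase i, (η ^ 2)⁻¹ ≤ ((x - X n k) ^ 2)⁻¹ := by
    intro k hk
    obtain ⟨hki, hkF⟩ := Finset.mem_erase.1 hk
    obtain ⟨hkr, hk1, hk2⟩ := Finset.mem_filter.1 hkF
    have hx0 : x - X n k ≠ 0 := sub_ne_zero.2 (hne k (Finset.mem_erase.2 ⟨hki, hkr⟩))
    have habs : |x - X n k| ≤ η := abs_le.2 ⟨by linarith, by linarith⟩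
    have hsq : (x - X n k) ^ 2 ≤ η ^ 2 := sq_le_sq.2 (habs.trans (le_abs_self _))
    have : 0 < (x - X n k) ^ 2 := by positivity
    gcongr
  have hcard : (F.card : ℝ) - 1 ≤ ((F.erase i).card : ℝ) := by
    have := Finset.pred_card_le_card_erase (s := F) (a := i)
    have h2 : F.card ≤ (F.erase i).card + 1 := by omega
    have h3 : (F.card : ℝ) ≤ (F.erase i).card + 1 := by exact_mod_cast h2
    linarith
  have hBη : B * η ^ 2 ≤ m * η / 4 := by
    have h1 : 8 * B < K * m := by rwa [div_lt_iff₀ hm0] at hKB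
    have h2 : 8 * B * η ≤ K * m * η := mul_le_mul_of_nonneg_right h1.le hη0.le
    have h3 : 8 * B * η ≤ 2 * m := by nlinarith
    nlinarith
  calc (n + 1 : ℝ) * B = (n + 1 : ℝ) * (B * η ^ 2) * (η ^ 2)⁻¹ := by field_simp
    _ ≤ ((F.erase i).card : ℝ) * (η ^ 2)⁻¹ := by
        have : (n + 1 : ℝ) * (B * η ^ 2) ≤ (n + 1 : ℝ) * (m * η / 4) := by gcongr
        gcongr
        linarith
    _ = ∑ k ∈ F.erase i, (η ^ 2)⁻¹ := by rw [Finset.sum_const, nsmul_eq_mul]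
    _ ≤ ∑ k ∈ F.erase i, ((x - X n k) ^ 2)⁻¹ := Finset.sum_le_sum hterm
    _ ≤ ∑ k ∈ (Finset.range (n + 1)).erase i, ((x - X n k) ^ 2)⁻¹ :=
        Finset.sum_le_sum_of_subset_of_nonneg
          (Finset.erase_subset_erase _ (Finset.filter_subset _ _)) (fun _ _ _ => by positivity)

/-- The logarithm of `|lagrangeBasis X φ n i|`. -/
noncomputable def logLagrange (X : ℕ → ℕ → ℝ) (φ : ℕ → ℝ → ℝ) (n i : ℕ) (x : ℝ) : ℝ :=
  ∑ k ∈ (Finset.range (n + 1)).erase i, Real.log (x - X n k) -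
    ∑ k ∈ (Finset.range (n + 1)).erase i, Real.log (X n i - X n k) +
    (n + 1 : ℝ) * (φ n (X n i) - φ n x)

lemma abs_lagrangeBasis_eq_exp {X : ℕ → ℕ → ℝ} {φ : ℕ → ℝ → ℝ} {n i : ℕ} {x : ℝ}
    (hx : ∀ k ∈ (Finset.range (n + 1)).erase i, x ≠ X n k)
    (hi : ∀ k ∈ (Finset.range (n + 1)).erase i, X n i ≠ X n k) :
    |lagrangeBasis X φ n i x| = Real.exp (logLagrange X φ n i x) := by
  have h : ∀ y, (∀ k ∈ (Finset.range (n + 1)).erase i, y ≠ X n k) →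
      |∏ k ∈ (Finset.range (n + 1)).erase i, (y - X n k)| =
        Real.exp (∑ k ∈ (Finset.range (n + 1)).erase i, Real.log (y - X n k)) := by
    intro y hy
    rw [Finset.abs_prod, Real.exp_sum]
    exact Finset.prod_congr rfl fun k hk =>
      (Real.exp_log_eq_abs (sub_ne_zero.2 (hy k hk))).symm
  rw [lagrangeBasis, abs_mul, abs_div, h x hx, h _ hi, Real.abs_exp, ← Real.exp_sub,
    ← Real.exp_add, logLagrange]

lemma logLagrange_add_log {X : ℕ → ℕ → ℝ} {φ : ℕ → ℝ → ℝ} {n i : ℕ} (hi : i ≤ n) (x : ℝ) :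
    logLagrange X φ n i x + Real.log (x - X n i) =
      -((n + 1 : ℝ) * discretePotential X φ n x) + ((n + 1 : ℝ) * φ n (X n i) -
        ∑ k ∈ (Finset.range (n + 1)).erase i, Real.log (X n i - X n k)) := by
  have hi' : i ∈ Finset.range (n + 1) := Finset.mem_range.2 (by omega)
  have hn : (n + 1 : ℝ) ≠ 0 := by positivity
  have hU : (n + 1 : ℝ) * discretePotential X φ n x =
      -(∑ k ∈ Finset.range (n + 1), Real.log (x - X n k)) + (n + 1 : ℝ) * φ n x := by
    simp only [discretePotential, one_div, Real.log_inv, Real.log_abs, Finset.sum_neg_distrib]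
    field_simp
  rw [hU, ← Finset.add_sum_erase _ _ hi', logLagrange]
  ring

lemma hasDerivAt_logLagrange {X : ℕ → ℕ → ℝ} {φ : ℕ → ℝ → ℝ} {n i : ℕ} {x d : ℝ}
    (hx : ∀ k ∈ (Finset.range (n + 1)).erase i, x ≠ X n k) (hφ : HasDerivAt (φ n) d x) :
    HasDerivAt (logLagrange X φ n i)
      (∑ k ∈ (Finset.range (n + 1)).erase i, (x - X n k)⁻¹ - (n + 1 : ℝ) * d) x := by
  have h1 : HasDerivAt (fun x => ∑ k ∈ (Finset.range (n + 1)).erase i, Real.log (x - X n k))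
      (∑ k ∈ (Finset.range (n + 1)).erase i, (x - X n k)⁻¹) x :=
    HasDerivAt.fun_sum fun k hk => by
      simpa using ((hasDerivAt_id x).sub_const (X n k)).log (sub_ne_zero.2 (hx k hk))
  have h2 := (h1.sub_const (∑ k ∈ (Finset.range (n + 1)).erase i, Real.log (X n i - X n k))).add
    ((hφ.const_sub (φ n (X n i))).const_mul (n + 1 : ℝ))
  exact h2.congr_deriv (by ring)

/-- At a critical point of the discrete potential, the slope of `logLagrange` is that of
`-log |x - x_i|`. -/
lemma slope_logLagrange_of_deriv_eq_zero {X : ℕ → ℕ → ℝ} {φ : ℕ → ℝ → ℝ} {n i : ℕ} {x d : ℝ}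
    (hi : i ≤ n) (hx : ∀ k ∈ Finset.range (n + 1), x ≠ X n k) (hφ : HasDerivAt (φ n) d x)
    (hcrit : deriv (discretePotential X φ n) x = 0) :
    ∑ k ∈ (Finset.range (n + 1)).erase i, (x - X n k)⁻¹ - (n + 1 : ℝ) * d = -(x - X n i)⁻¹ := by
  have hi' : i ∈ Finset.range (n + 1) := Finset.mem_range.2 (by omega)
  have hn : (n + 1 : ℝ) ≠ 0 := by positivity
  have h1 : HasDerivAt (fun x => ∑ k ∈ Finset.range (n + 1), Real.log (1 / |x - X n k|))
      (∑ k ∈ Finset.range (n + 1), -(x - X n k)⁻¹) x :=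
    HasDerivAt.fun_sum fun k hk => by
      simpa only [one_div, Real.log_inv, Real.log_abs, id] using
        (((hasDerivAt_id x).sub_const (X n k)).log (sub_ne_zero.2 (hx k hk))).fun_neg
  have h2 : HasDerivAt (discretePotential X φ n)
      (1 / (n + 1 : ℝ) * (∑ k ∈ Finset.range (n + 1), -(x - X n k)⁻¹) + d) x :=
    (h1.const_mul (1 / (n + 1 : ℝ))).add hφ
  rw [h2.deriv, ← Finset.add_sum_erase _ _ hi', Finset.sum_neg_distrib] at hcrit
  field_simp at hcrit
  simp only [inv_eq_one_div]
  linarith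

theorem stmt_13 (X : ℕ → ℕ → ℝ) (w : ℝ → ℝ) (φ : ℕ → ℝ → ℝ) (φl : ℝ → ℝ)
    (φ' φ'' : ℕ → ℝ → ℝ) (M M₂ a₁ a₂ b₁ b₂ : ℝ)
    (ζ : ℕ → ℕ → ℝ) (δm δp : ℕ → ℝ) (C : ℝ)
    (hXorder : ∀ n, 1 ≤ n → ∀ i j : ℕ, i < j → j ≤ n → X n i < X n j)
    (hXmem : ∀ n, 1 ≤ n → ∀ i, i ≤ n → X n i ∈ Set.Icc (-1 : ℝ) 1)
    (hw_cont : ContinuousOn w (Set.Icc (-1 : ℝ) 1))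
    (hw_pos : ∀ t ∈ Set.Icc (-1 : ℝ) 1, 0 < w t)
    (hw_int : (∫ t in (-1 : ℝ)..1, w t) = 1)
    (hobeys : ObeysDensity X w)
    (hφd1 : ∀ n, ∀ x ∈ Set.Icc (-1 : ℝ) 1, HasDerivAt (φ n) (φ' n x) x)
    (hφd2 : ∀ n, ∀ x ∈ Set.Icc (-1 : ℝ) 1, HasDerivAt (φ' n) (φ'' n x) x)
    (hφ''cont : ∀ n, ContinuousOn (φ'' n) (Set.Icc (-1 : ℝ) 1))
    (hM : ∀ n, ∀ x ∈ Set.Icc (-1 : ℝ) 1, M ≤ φ'' n x)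
    (hφunif : TendstoUniformlyOn φ φl Filter.atTop (Set.Icc (-1 : ℝ) 1))
    (ha₁ : 0 < a₁) (ha₂ : 0 < a₂)
    (hgap : ∀ n : ℕ, 1 ≤ n → ∀ i, 1 ≤ i → i ≤ n →
      a₁ * (n : ℝ) ^ (-b₁) ≤ X n i - X n (i - 1) ∧ X n i - X n (i - 1) ≤ a₂ * (n : ℝ) ^ (-b₂))
    (hφ'bd : ∀ n : ℕ, 1 ≤ n →
      ∀ x ∈ Set.Ioo (-1 + a₁ * (n : ℝ) ^ (-b₁ - 1)) (1 - a₁ * (n : ℝ) ^ (-b₁ - 1)),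
        |φ' n x| < M₂ * Real.log n)
    (hζmem : ∀ n : ℕ, 1 ≤ n → ∀ i, 1 ≤ i → i ≤ n → ζ n i ∈ Set.Ioo (X n (i - 1)) (X n i))
    (hζcrit : ∀ n : ℕ, 1 ≤ n → ∀ i, 1 ≤ i → i ≤ n → deriv (discretePotential X φ n) (ζ n i) = 0)
    (hδm : ∀ n, 0 ≤ δm n) (hδp : ∀ n, 0 ≤ δp n)
    (hδ : ∀ᶠ n : ℕ in Filter.atTop, ∀ i, 1 ≤ i → i ≤ n →
      -δm n ≤ discretePotential X φ n (ζ n i) - continuousPotential w φl (ζ n i) ∧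
        discretePotential X φ n (ζ n i) - continuousPotential w φl (ζ n i) ≤ δp n)
    (hUconst : ∀ x ∈ Set.Icc (-1 : ℝ) 1, continuousPotential w φl x = C)
    :
    ∃ N : ℕ, ∀ n : ℕ, N ≤ n → ∀ i, 0 < i → i < n →
      ∀ x ∈ Set.Ioo (X n (i - 1)) (X n (i + 1)),
        |lagrangeBasis X φ n i x| ≤ Real.exp ((n + 1 : ℝ) * (δm n + δp n) + 1) := by
  obtain ⟨N, hN⟩ := Filter.eventually_atTop.1
    ((eventually_mul_le_sum_inv_sq X w hw_cont hw_pos hobeys (-M)).and hδ)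
  refine ⟨N, fun n hn i hi0 hin y hy => ?_⟩
  obtain ⟨hsum, hδn⟩ := hN n hn
  have hn1 : 1 ≤ n := by omega
  have hmono : ∀ j k, j ≤ k → k ≤ n → X n j ≤ X n k := by
    intro j k hjk hk
    rcases hjk.eq_or_lt with rfl | h
    · exact le_rfl
    · exact (hXorder n hn1 j k h hk).le
  have hIoo : ∀ x ∈ Set.Ioo (X n (i - 1)) (X n (i + 1)), x ∈ Set.Icc (-1 : ℝ) 1 := fun x hx =>
    ⟨(hXmem n hn1 (i - 1) (by omega)).1.trans hx.1.le,
      hx.2.le.trans (hXmem n hn1 (i + 1) (by omega)).2⟩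
  have hne : ∀ x ∈ Set.Ioo (X n (i - 1)) (X n (i + 1)),
      ∀ k ∈ (Finset.range (n + 1)).erase i, x ≠ X n k := by
    intro x hx k hk hxk
    obtain ⟨hki, hkr⟩ := Finset.mem_erase.1 hk
    have hkn := Finset.mem_range.1 hkr
    rcases lt_or_gt_of_ne hki with h | h
    · have := hmono k (i - 1) (by omega) (by omega)
      linarith [hx.1]
    · have := hmono (i + 1) k (by omega) (by omega)
      linarith [hx.2]
  have hX1 := hXorder n hn1 (i - 1) i (by omega) (by omega)
  have hX2 := hXorder n hn1 i (i + 1) (by omega) (by omega)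
  have hζ1 := hζmem n hn1 i (by omega) (by omega)
  have hζ2 := hζmem n hn1 (i + 1) (by omega) (by omega)
  rw [Nat.add_sub_cancel] at hζ2
  have hc : X n i ∈ Set.Ioo (X n (i - 1)) (X n (i + 1)) := ⟨hX1, hX2⟩
  have hp : ζ n i ∈ Set.Ioo (X n (i - 1)) (X n (i + 1)) := ⟨hζ1.1, hζ1.2.trans hX2⟩
  have hq : ζ n (i + 1) ∈ Set.Ioo (X n (i - 1)) (X n (i + 1)) := ⟨hX1.trans hζ2.1, hζ2.2⟩
  have hall : ∀ x ∈ Set.Ioo (X n (i - 1)) (X n (i + 1)), x ≠ X n i →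
      ∀ k ∈ Finset.range (n + 1), x ≠ X n k := by
    intro x hx hxi k hk
    rcases eq_or_ne k i with rfl | h
    · exact hxi
    · exact hne x hx k (Finset.mem_erase.2 ⟨h, hk⟩)
  set L' : ℝ → ℝ := fun x =>
    ∑ k ∈ (Finset.range (n + 1)).erase i, (x - X n k)⁻¹ - (n + 1 : ℝ) * φ' n x with hL'
  have hL : ∀ x ∈ Set.Ioo (X n (i - 1)) (X n (i + 1)),
      HasDerivAt (logLagrange X φ n i) (L' x) x := fun x hx =>
    hasDerivAt_logLagrange (hne x hx) (hφd1 n x (hIoo x hx))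
  have hL2 : ∀ x ∈ Set.Ioo (X n (i - 1)) (X n (i + 1)), HasDerivAt L'
      (∑ k ∈ (Finset.range (n + 1)).erase i, -((x - X n k) ^ 2)⁻¹ - (n + 1 : ℝ) * φ'' n x) x := by
    intro x hx
    refine (HasDerivAt.fun_sum fun k hk => ?_).sub
      ((hφd2 n x (hIoo x hx)).const_mul (n + 1 : ℝ))
    have := ((hasDerivAt_id x).sub_const (X n k)).fun_inv (sub_ne_zero.2 (hne x hx k hk))
    simpa [neg_div] using this
  have hanti : AntitoneOn L' (Set.Ioo (X n (i - 1)) (X n (i + 1))) := by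
    refine antitoneOn_of_deriv_nonpos (convex_Ioo _ _)
      (fun x hx => (hL2 x hx).continuousAt.continuousWithinAt)
      (fun x hx => (hL2 x (interior_subset hx)).differentiableAt.differentiableWithinAt) ?_
    intro x hx
    have hx := interior_subset hx
    rw [(hL2 x hx).deriv, Finset.sum_neg_distrib]
    have h1 := hsum i x (hIoo x hx) (hne x hx)
    have h2 : (n + 1 : ℝ) * M ≤ (n + 1 : ℝ) * φ'' n x :=
      mul_le_mul_of_nonneg_left (hM n x (hIoo x hx)) (by positivity)
    linarith
  rw [abs_lagrangeBasis_eq_exp (hne y hy) (hne _ hc), Real.exp_le_exp]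
  refine le_add_one_of_tangent (fun x hx z hz => le_tangent_of_antitoneOn_deriv hL hanti hx hz)
    hp hc hq hζ1.2 hζ2.1 ?_ ?_ ?_ ?_ hy
  · simp [logLagrange]
  · have := slope_logLagrange_of_deriv_eq_zero hin.le (hall _ hp hζ1.2.ne)
      (hφd1 n _ (hIoo _ hp)) (hζcrit n hn1 i (by omega) (by omega))
    rw [hL']
    simp only
    rw [this, one_div, ← inv_neg, neg_sub]
  · have := slope_logLagrange_of_deriv_eq_zero hin.le (hall _ hq hζ2.1.ne')
      (hφd1 n _ (hIoo _ hq)) (hζcrit n hn1 (i + 1) (by omega) (by omega))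
    rw [hL']
    simp only
    rw [this, one_div]
  · rw [← Real.log_neg_eq_log (X n i - ζ n i), neg_sub, logLagrange_add_log hin.le,
      logLagrange_add_log hin.le]
    have h1 := hδn i (by omega) (by omega)
    have h2 := hδn (i + 1) (by omega) (by omega)
    rw [hUconst _ (hIoo _ hp)] at h1
    rw [hUconst _ (hIoo _ hq)] at h2
    have hn0 : (0 : ℝ) ≤ n + 1 := by positivity
    have hdiff : |discretePotential X φ n (ζ n i) - discretePotential X φ n (ζ n (i + 1))| ≤
        δm n + δp n := abs_le.2 ⟨by linarith, by linarith⟩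
    calc _ = (n + 1 : ℝ) *
          |discretePotential X φ n (ζ n i) - discretePotential X φ n (ζ n (i + 1))| := by
          rw [← abs_of_nonneg hn0, ← abs_mul, abs_of_nonneg hn0]
          congr 1
          ring
      _ ≤ _ := mul_le_mul_of_nonneg_left hdiff hn0
end
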